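/- Let (X,T) be a topological dynamical system and f ∈ C(X,ℝ). If there exists an ergodic T-invariant Borel probability measure μ with P_μ(T,f) = P(T,f), then there exist x ∈ X, a closed subset A(x) ⊆ W^s(x,T), and a closed subset B(x) ⊆ W^u(x,T) such that: (1) lim_{n→∞} diam(T^n A(x)) = 0 and P(T^{-1},f,A(x)) = P(T,f); (2) lim_{n→∞} diam(T^{-n} B(x)) = 0 and P(T,f,B(x)) = P(T,f). -/

import Mathlib

open Filter Set Topology MeasureTheory

noncomputable section

variable {X : Type*}

/-- Birkhoff sum `f_n(x) = ∑_{j<n} f(T^j x)`. -/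
def birk (T : X → X) (f : X → ℝ) (n : ℕ) (x : X) : ℝ :=
  ∑ j ∈ Finset.range n, f (T^[j] x)

/-- `P_n(T,f,δ,K)`: supremum of `∑_{x∈E} exp f_n(x)` over `(n,δ)`-separated
subsets `E ⊆ K`. -/
def sepPn [MetricSpace X] (T : X → X) (f : X → ℝ) (n : ℕ) (δ : ℝ) (K : Set X) : ℝ :=
  sSup { r : ℝ | ∃ E : Finset X, ↑E ⊆ K ∧
    (∀ x ∈ E, ∀ y ∈ E, x ≠ y → ∃ i < n, δ < dist (T^[i] x) (T^[i] y)) ∧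
    r = ∑ x ∈ E, Real.exp (birk T f n x) }

/-- The topological pressure of `T` for the subset `K`:
`P(T,f,K) = lim_{δ→0} limsup_n (1/n) log P_n(T,f,δ,K)`; since the expression is
nonincreasing in `δ`, the limit is the supremum over `δ > 0`. -/
def pres [MetricSpace X] (T : X → X) (f : X → ℝ) (K : Set X) : EReal :=
  ⨆ (δ : ℝ) (_ : 0 < δ), atTop.limsup fun n : ℕ =>
    ((Real.log (sepPn T f n δ K) / n : ℝ) : EReal)

/-- The `ε`-stable set `W^s_ε(x,T)`. -/
def epsStable [MetricSpace X] (T : X → X) (ε : ℝ) (x : X) : Set X :=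
  { y | ∀ n : ℕ, dist (T^[n] x) (T^[n] y) ≤ ε }

/-- The topological pressure of the preimages of the `ε`-stable set of `x`:
`P_s(T,f,x,ε) = lim_{δ→0} limsup_n (1/n) log P_n(T,f,δ,T^{-n}W^s_ε(x,T))`. -/
def Ps [MetricSpace X] (T : X → X) (f : X → ℝ) (x : X) (ε : ℝ) : EReal :=
  ⨆ (δ : ℝ) (_ : 0 < δ), atTop.limsup fun n : ℕ =>
    ((Real.log (sepPn T f n δ ((T^[n]) ⁻¹' epsStable T ε x)) / n : ℝ) : EReal)

/-- A finite open cover of `X`. -/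
def IsOpenCover [TopologicalSpace X] (𝒰 : Finset (Set X)) : Prop :=
  (∀ U ∈ 𝒰, IsOpen U) ∧ ⋃₀ (𝒰 : Set (Set X)) = univ

/-- A finite Borel cover of `X`. -/
def IsBorelCover [MeasurableSpace X] (𝒱 : Finset (Set X)) : Prop :=
  (∀ V ∈ 𝒱, MeasurableSet V) ∧ ⋃₀ (𝒱 : Set (Set X)) = univ

/-- `𝒱` refines the iterated cover `𝒰_0^{n-1} = ⋁_{i<n} T^{-i}𝒰`. -/
def RefinesIter (T : X → X) (𝒰 : Finset (Set X)) (n : ℕ) (𝒱 : Finset (Set X)) : Prop :=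
  ∀ V ∈ 𝒱, ∃ g : Fin n → Set X, (∀ i, g i ∈ 𝒰) ∧ V ⊆ ⋂ i : Fin n, (T^[(i : ℕ)]) ⁻¹' g i

/-- `P_n(T,f,𝒰,K)`: infimum over finite Borel covers `𝒱` refining `𝒰_0^{n-1}` of
`∑_{V∈𝒱} sup_{x ∈ V∩K} exp f_n(x)` (an empty summand contributes `0`, which is
`Real.sSup ∅`). -/
def covPn [MeasurableSpace X] (T : X → X) (f : X → ℝ) (𝒰 : Finset (Set X)) (n : ℕ)
    (K : Set X) : ℝ :=
  sInf { r : ℝ | ∃ 𝒱 : Finset (Set X), IsBorelCover 𝒱 ∧ RefinesIter T 𝒰 n 𝒱 ∧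
    r = ∑ V ∈ 𝒱, sSup ((fun x => Real.exp (birk T f n x)) '' (V ∩ K)) }

/-- A finite Borel partition of `X`. -/
def IsFinPartition [MeasurableSpace X] (α : Finset (Set X)) : Prop :=
  (∀ A ∈ α, MeasurableSet A) ∧ ⋃₀ (α : Set (Set X)) = univ ∧
    (α : Set (Set X)).Pairwise Disjoint

/-- `H_μ(⋁_{i<n} T^{-i}α)`, computed over all atoms `⋂_{i<n} T^{-i} A_i`. -/
def dynH [MeasurableSpace X] (μ : Measure X) (T : X → X) (α : Finset (Set X)) (n : ℕ) : ℝ :=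
  ∑ g : Fin n → α, Real.negMulLog ((μ (⋂ i : Fin n, (T^[(i : ℕ)]) ⁻¹' (g i : Set X))).toReal)

/-- `h_μ(T,α) = lim_n (1/n) H_μ(α_0^{n-1})`, which for an invariant measure equals
the infimum of `(1/n) H_μ(α_0^{n-1})` over `n ≥ 1`. -/
def entPart [MeasurableSpace X] (μ : Measure X) (T : X → X) (α : Finset (Set X)) : ℝ :=
  ⨅ n : ℕ, dynH μ T α (n + 1) / (n + 1 : ℝ)

/-- The measure-theoretic entropy `h_μ(T)`. -/
def mEnt [MeasurableSpace X] (μ : Measure X) (T : X → X) : EReal :=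
  ⨆ (α : Finset (Set X)) (_ : IsFinPartition α), ((entPart μ T α : ℝ) : EReal)

/-- The measure-theoretic pressure `P_μ(T,f) = h_μ(T) + ∫ f dμ`. -/
def mPres [MeasurableSpace X] (μ : Measure X) (T : X → X) (f : X → ℝ) : EReal :=
  mEnt μ T + ((∫ x, f x ∂μ : ℝ) : EReal)

/-- The stable set `W^s(x,T)`. -/
def stableSet [MetricSpace X] (T : X → X) (x : X) : Set X :=
  { y | Tendsto (fun n : ℕ => dist (T^[n] x) (T^[n] y)) atTop (𝓝 0) }

/-- A Cantor set: a nonempty compact perfect totally disconnected set. -/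
def IsCantorSet [TopologicalSpace X] (C : Set X) : Prop :=
  C.Nonempty ∧ IsCompact C ∧ Perfect C ∧ IsTotallyDisconnected C

/-- A weakly mixing set for `T`. -/
def IsWeaklyMixingSet [TopologicalSpace X] (T : X → X) (A : Set X) : Prop :=
  A.Nonempty ∧ IsClosed A ∧
  ∃ B : Set X, B ⊆ A ∧
    (∃ C : ℕ → Set X, (∀ n, IsCantorSet (C n)) ∧ B = ⋃ n, C n) ∧
    closure B = A ∧
    ∀ C : Set X, C ⊆ B → IsCantorSet C →
      ∀ g : C → X, Continuous g → (∀ c : C, g c ∈ A) →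
        ∃ φ : ℕ → ℕ, StrictMono φ ∧
          ∀ c : C, Tendsto (fun i => T^[φ i] (c : X)) atTop (𝓝 (g c))

/-- Every fibre of `u` is measurable. -/
def FibMeas {A : Type*} [MeasurableSpace X] (u : X → A) : Prop :=
  ∀ a, MeasurableSet (u ⁻¹' {a} : Set X)

/-- Shannon entropy of a finite-valued observable. -/
def ent {A : Type*} [MeasurableSpace X] [Fintype A] (μ : Measure X) (u : X → A) : ℝ :=
  ∑ a, Real.negMulLog (μ.real (u ⁻¹' {a}))

theorem FibMeas.pair {A B : Type*} [MeasurableSpace X] {u : X → A} {v : X → B}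
    (hu : FibMeas u) (hv : FibMeas v) : FibMeas fun x => (u x, v x) := by
  rintro ⟨a, b⟩
  have : (fun x => (u x, v x)) ⁻¹' {(a, b)} = u ⁻¹' {a} ∩ v ⁻¹' {b} := by
    ext x; simp
  rw [this]
  exact (hu a).inter (hv b)

theorem FibMeas.pi {ι A : Type*} [Finite ι] [MeasurableSpace X] {u : ι → X → A}
    (hu : ∀ i, FibMeas (u i)) : FibMeas fun x i => u i x := by
  intro g
  have : (fun x i => u i x) ⁻¹' {g} = ⋂ i, u i ⁻¹' {g i} := by
    ext x; simp [funext_iff]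
  rw [this]
  exact MeasurableSet.iInter fun i => hu i (g i)

theorem FibMeas.comp {A : Type*} [MeasurableSpace X] {u : X → A} (hu : FibMeas u) {T : X → X}
    (hT : Measurable T) : FibMeas fun x => u (T x) :=
  fun a => hT (hu a)

theorem FibMeas.preimage {A : Type*} [Finite A] [MeasurableSpace X] {u : X → A} (hu : FibMeas u)
    (s : Set A) : MeasurableSet (u ⁻¹' s) := by
  have : u ⁻¹' s = ⋃ a ∈ s, u ⁻¹' {a} := by ext x; simp
  rw [this]
  exact MeasurableSet.biUnion (Set.to_countable s) fun a _ => hu a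

section Entropy

variable {A B C : Type*} [Fintype A] [Fintype B] [Fintype C] [MeasurableSpace X]

theorem sum_real_inter_fiber (μ : Measure X) [IsFiniteMeasure μ] {v : X → B} (hv : FibMeas v)
    (s : Set X) : ∑ b, μ.real (s ∩ v ⁻¹' {b}) = μ.real s := by
  have h := measureReal_biUnion_finset (μ := μ.restrict s) (s := Finset.univ)
    (f := fun b => v ⁻¹' {b}) ?_ fun b _ => hv b
  · have h2 : (⋃ b ∈ Finset.univ, v ⁻¹' {b}) = univ := by ext; simp
    rw [h2] at h
    simp only [measureReal_restrict_apply (hv _), measureReal_restrict_apply MeasurableSet.univ]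
      at h
    simpa [inter_comm] using h.symm
  · intro b _ b' _ hb
    exact Disjoint.preimage v (by simpa using hb)

theorem integral_comp_fibMeas (μ : Measure X) [IsFiniteMeasure μ] {u : X → A} (hu : FibMeas u)
    (φ : A → ℝ) : ∫ x, φ (u x) ∂μ = ∑ a, μ.real (u ⁻¹' {a}) * φ a := by
  classical
  have h : ∀ x, φ (u x) = ∑ a, (u ⁻¹' {a}).indicator (fun _ => φ a) x := by
    intro x
    simp [Set.indicator_apply]
  simp_rw [h]
  rw [integral_finsetSum]
  · simp_rw [integral_indicator_const _ (hu _), smul_eq_mul]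
  · intro a _
    exact (integrable_const _).indicator (hu a)

theorem integrable_comp_fibMeas (μ : Measure X) [IsFiniteMeasure μ] {u : X → A} (hu : FibMeas u)
    (φ : A → ℝ) : Integrable (fun x => φ (u x)) μ := by
  classical
  have h : ∀ x, φ (u x) = ∑ a, (u ⁻¹' {a}).indicator (fun _ => φ a) x := by
    intro x
    simp [Set.indicator_apply]
  simp_rw [h]
  exact integrable_finsetSum _ fun a _ => (integrable_const _).indicator (hu a)

theorem sum_negMulLog_sub_le {ι : Type*} (s : Finset ι) (p g : ι → ℝ) (hp : ∀ a ∈ s, 0 ≤ p a) :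
    ∑ a ∈ s, Real.negMulLog (p a) - Real.negMulLog (∑ a ∈ s, p a) + ∑ a ∈ s, p a * g a ≤
      (∑ a ∈ s, p a) * Real.log (∑ a ∈ s, Real.exp (g a)) := by
  set P := ∑ a ∈ s, p a with hP
  set Z := ∑ a ∈ s, Real.exp (g a) with hZ
  have hP0 : 0 ≤ P := Finset.sum_nonneg hp
  rcases hP0.eq_or_lt with h0 | hPpos
  · have hz : ∀ a ∈ s, p a = 0 := (Finset.sum_eq_zero_iff_of_nonneg hp).1 h0.symm
    have h1 : ∑ a ∈ s, Real.negMulLog (p a) = 0 :=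
      Finset.sum_eq_zero fun a ha => by simp [hz a ha]
    have h2 : ∑ a ∈ s, p a * g a = 0 := Finset.sum_eq_zero fun a ha => by simp [hz a ha]
    rw [h1, h2, ← h0]; simp
  · have hs : s.Nonempty := by
      by_contra h
      rw [Finset.not_nonempty_iff_eq_empty] at h
      simp [hP, h] at hPpos
    have hZpos : 0 < Z := Finset.sum_pos (fun a _ => Real.exp_pos _) hs
    have key : ∀ a ∈ s, Real.negMulLog (p a) + p a * Real.log P + p a * g a - p a * Real.log Z ≤
        P * Real.exp (g a) / Z - p a := by
      intro a ha
      rcases (hp a ha).eq_or_lt with h | h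
      · rw [← h]; simp; positivity
      · have hl := Real.log_le_sub_one_of_pos (x := P * Real.exp (g a) / (Z * p a)) (by positivity)
        rw [Real.log_div (by positivity) (by positivity), Real.log_mul (by positivity)
          (by positivity), Real.log_mul (by positivity) (by positivity), Real.log_exp] at hl
        have h2 := mul_le_mul_of_nonneg_left hl h.le
        have h3 : p a * (P * Real.exp (g a) / (Z * p a) - 1) = P * Real.exp (g a) / Z - p a := by
          field_simp
        rw [h3] at h2
        unfold Real.negMulLog
        linarith
    have hsum := Finset.sum_le_sum key
    have hr : ∑ a ∈ s, (P * Real.exp (g a) / Z - p a) = 0 := by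
      rw [Finset.sum_sub_distrib, ← Finset.sum_div, ← Finset.mul_sum, ← hZ, ← hP]
      field_simp
      simp
    rw [hr, Finset.sum_sub_distrib, Finset.sum_add_distrib, Finset.sum_add_distrib,
      ← Finset.sum_mul, ← Finset.sum_mul, ← hP] at hsum
    have : Real.negMulLog P = -(P * Real.log P) := by unfold Real.negMulLog; ring
    rw [this]
    linarith

/-- Conditional Gibbs inequality: a bound for `H(u | v) + ∫ g(u, v)`. -/
theorem ent_pair_sub_add_le (μ : Measure X) [IsFiniteMeasure μ] {u : X → A} {v : X → B}
    (hu : FibMeas u) (g : A → B → ℝ) (s : B → Finset A)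
    (hs : ∀ a b, a ∉ s b → μ.real (u ⁻¹' {a} ∩ v ⁻¹' {b}) = 0) :
    ent μ (fun x => (u x, v x)) - ent μ v
      + ∑ a, ∑ b, μ.real (u ⁻¹' {a} ∩ v ⁻¹' {b}) * g a b ≤
    ∑ b, μ.real (v ⁻¹' {b}) * Real.log (∑ a ∈ s b, Real.exp (g a b)) := by
  have e1 : ent μ (fun x => (u x, v x)) =
      ∑ b, ∑ a, Real.negMulLog (μ.real (u ⁻¹' {a} ∩ v ⁻¹' {b})) := by
    unfold ent
    rw [Fintype.sum_prod_type_right]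
    refine Finset.sum_congr rfl fun b _ => Finset.sum_congr rfl fun a _ => ?_
    congr 2
    ext x; simp
  rw [e1, ent, Finset.sum_comm (γ := A), ← Finset.sum_sub_distrib, ← Finset.sum_add_distrib]
  refine Finset.sum_le_sum fun b _ => ?_
  have hz : ∀ a ∈ Finset.univ, a ∉ s b → μ.real (u ⁻¹' {a} ∩ v ⁻¹' {b}) = 0 :=
    fun a _ ha => hs a b ha
  have h1 : ∑ a, Real.negMulLog (μ.real (u ⁻¹' {a} ∩ v ⁻¹' {b})) =
      ∑ a ∈ s b, Real.negMulLog (μ.real (u ⁻¹' {a} ∩ v ⁻¹' {b})) :=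
    (Finset.sum_subset (Finset.subset_univ _) fun a h h' => by simp [hz a h h']).symm
  have h2 : ∑ a, μ.real (u ⁻¹' {a} ∩ v ⁻¹' {b}) * g a b =
      ∑ a ∈ s b, μ.real (u ⁻¹' {a} ∩ v ⁻¹' {b}) * g a b :=
    (Finset.sum_subset (Finset.subset_univ _) fun a h h' => by simp [hz a h h']).symm
  have h3 : μ.real (v ⁻¹' {b}) = ∑ a ∈ s b, μ.real (u ⁻¹' {a} ∩ v ⁻¹' {b}) := by
    rw [Finset.sum_subset (Finset.subset_univ _) hz, ← sum_real_inter_fiber μ hu]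
    simp_rw [inter_comm]
  rw [h1, h2, h3]
  exact sum_negMulLog_sub_le _ _ _ fun a _ => measureReal_nonneg

theorem negMulLog_sum_le {ι : Type*} (s : Finset ι) (p : ι → ℝ) (hp : ∀ a ∈ s, 0 ≤ p a) :
    Real.negMulLog (∑ a ∈ s, p a) ≤ ∑ a ∈ s, Real.negMulLog (p a) := by
  have : Real.negMulLog (∑ a ∈ s, p a) = ∑ a ∈ s, -(p a) * Real.log (∑ a ∈ s, p a) := by
    rw [← Finset.sum_mul, Finset.sum_neg_distrib, Real.negMulLog]
  rw [this]
  refine Finset.sum_le_sum fun a ha => ?_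
  rcases (hp a ha).eq_or_lt with h | h
  · rw [← h]; simp
  · have := Real.log_le_log h (Finset.single_le_sum hp ha)
    unfold Real.negMulLog
    nlinarith

theorem ent_le_of_factor (μ : Measure X) [IsFiniteMeasure μ] {u : X → A} {v : X → B}
    (hv : FibMeas v) (h : ∀ x y, v x = v y → u x = u y) :
    ent μ u ≤ ent μ v := by
  have h1 : ent μ u ≤ ∑ a, ∑ b, Real.negMulLog (μ.real (u ⁻¹' {a} ∩ v ⁻¹' {b})) := by
    refine Finset.sum_le_sum fun a _ => ?_
    rw [← sum_real_inter_fiber μ hv]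
    exact negMulLog_sum_le _ _ fun b _ => measureReal_nonneg
  refine h1.trans ?_
  rw [Finset.sum_comm]
  refine Finset.sum_le_sum fun b _ => ?_
  by_cases hb : ∃ x, v x = b
  · obtain ⟨x, rfl⟩ := hb
    rw [Finset.sum_eq_single (u x)]
    · have : u ⁻¹' {u x} ∩ v ⁻¹' {v x} = v ⁻¹' {v x} :=
        inter_eq_right.2 fun y hy => h _ _ hy
      rw [this]
    · intro a _ ha
      have : u ⁻¹' {a} ∩ v ⁻¹' {v x} = ∅ := by
        ext y
        simp only [mem_inter_iff, mem_preimage, mem_singleton_iff, mem_empty_iff_false, iff_false,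
          not_and]
        intro h1 h2
        exact ha (h1 ▸ h _ _ h2)
      simp [this]
    · simp
  · have : v ⁻¹' {b} = ∅ := by
      ext y
      simp only [mem_preimage, mem_singleton_iff, mem_empty_iff_false, iff_false]
      exact fun hy => hb ⟨y, hy⟩
    simp [this]

/-- Conditioning on more information decreases entropy: `H(u | v, w) ≤ H(u | w)`. -/
theorem ent_cond_anti (μ : Measure X) [IsFiniteMeasure μ] {u : X → A} {v : X → B} {w : X → C}
    (hu : FibMeas u) (hv : FibMeas v) :
    ent μ (fun x => (u x, (v x, w x))) + ent μ w ≤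
      ent μ (fun x => (u x, w x)) + ent μ (fun x => (v x, w x)) := by
  classical
  set p : A → C → ℝ := fun a c => μ.real (u ⁻¹' {a} ∩ w ⁻¹' {c}) with hp
  set q : C → ℝ := fun c => μ.real (w ⁻¹' {c}) with hq
  have hpq : ∀ a c, p a c ≤ q c := fun a c => measureReal_mono inter_subset_right
  have hqsum : ∀ c, ∑ a, p a c = q c := by
    intro c
    rw [hq, hp]
    simp_rw [inter_comm (u ⁻¹' _)]
    exact sum_real_inter_fiber μ hu _
  have hG := ent_pair_sub_add_le (v := fun x => (v x, w x)) μ hu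
    (fun a bc => Real.log (p a bc.2) - Real.log (q bc.2))
    (fun bc => Finset.univ.filter fun a => p a bc.2 ≠ 0) (by
      rintro a ⟨b, c⟩ h
      simp only [Finset.mem_filter, Finset.mem_univ, true_and, not_not] at h
      refine le_antisymm (h ▸ ?_) measureReal_nonneg
      refine measureReal_mono ?_
      rintro x ⟨h1, h2⟩
      simp only [mem_preimage, mem_singleton_iff, Prod.mk.injEq] at h2
      exact ⟨h1, h2.2⟩)
  have hR : ∑ bc : B × C, μ.real ((fun x => (v x, w x)) ⁻¹' {bc}) *
      Real.log (∑ a ∈ Finset.univ.filter (fun a => p a bc.2 ≠ 0),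
        Real.exp (Real.log (p a bc.2) - Real.log (q bc.2))) ≤ 0 := by
    refine Finset.sum_nonpos fun bc _ => ?_
    refine mul_nonpos_of_nonneg_of_nonpos measureReal_nonneg ?_
    refine Real.log_nonpos (Finset.sum_nonneg fun a _ => (Real.exp_pos _).le) ?_
    have : ∀ a ∈ Finset.univ.filter (fun a => p a bc.2 ≠ 0),
        Real.exp (Real.log (p a bc.2) - Real.log (q bc.2)) ≤ p a bc.2 / q bc.2 := by
      intro a ha
      have h0 : 0 < p a bc.2 :=
        lt_of_le_of_ne measureReal_nonneg (Ne.symm (Finset.mem_filter.1 ha).2)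
      have h1 : 0 < q bc.2 := h0.trans_le (hpq _ _)
      rw [Real.exp_sub, Real.exp_log h0, Real.exp_log h1]
    refine (Finset.sum_le_sum this).trans ?_
    refine (Finset.sum_le_sum_of_subset_of_nonneg (Finset.subset_univ _)
      fun a _ _ => div_nonneg measureReal_nonneg measureReal_nonneg).trans ?_
    rw [← Finset.sum_div, hqsum]
    exact div_self_le_one _
  have hL : ∑ a, ∑ bc : B × C, μ.real (u ⁻¹' {a} ∩ (fun x => (v x, w x)) ⁻¹' {bc}) *
      (Real.log (p a bc.2) - Real.log (q bc.2)) = ent μ w - ent μ (fun x => (u x, w x)) := by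
    have h1 : ∀ a, ∑ bc : B × C, μ.real (u ⁻¹' {a} ∩ (fun x => (v x, w x)) ⁻¹' {bc}) *
        (Real.log (p a bc.2) - Real.log (q bc.2)) =
        ∑ c, p a c * (Real.log (p a c) - Real.log (q c)) := by
      intro a
      rw [Fintype.sum_prod_type_right]
      refine Finset.sum_congr rfl fun c _ => ?_
      dsimp only
      rw [← Finset.sum_mul]
      congr 1
      rw [hp]
      simp only
      rw [← sum_real_inter_fiber μ hv]
      refine Finset.sum_congr rfl fun b _ => ?_
      congr 1
      ext x; simp; tauto
    simp_rw [h1]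
    have h2 : ent μ (fun x => (u x, w x)) = ∑ a, ∑ c, Real.negMulLog (p a c) := by
      unfold ent
      rw [Fintype.sum_prod_type]
      refine Finset.sum_congr rfl fun b _ => Finset.sum_congr rfl fun a _ => ?_
      congr 2
      ext x; simp
    have h3 : ent μ w = ∑ a, ∑ c, -(p a c * Real.log (q c)) := by
      rw [Finset.sum_comm]
      refine Finset.sum_congr rfl fun c _ => ?_
      rw [Finset.sum_neg_distrib, ← Finset.sum_mul, hqsum, Real.negMulLog]
      ring
    rw [h2, h3, ← Finset.sum_sub_distrib]
    refine Finset.sum_congr rfl fun a _ => ?_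
    rw [← Finset.sum_sub_distrib]
    refine Finset.sum_congr rfl fun c _ => ?_
    rw [Real.negMulLog]; ring
  have h4 := hG.trans hR
  rw [hL] at h4
  linarith

theorem ent_comp (μ : Measure X) {T : X → X} (hT : MeasurePreserving T μ μ) {u : X → A}
    (hu : FibMeas u) : ent μ (fun x => u (T x)) = ent μ u := by
  refine Finset.sum_congr rfl fun a _ => ?_
  have : (fun x => u (T x)) ⁻¹' {a} = T ⁻¹' (u ⁻¹' {a}) := rfl
  rw [this, Measure.real, hT.measure_preimage (hu a).nullMeasurableSet, ← Measure.real]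

end Entropy

section EntropyFunction

/-- The formal properties of the joint entropy of a stationary array of observables, indexed by
time and row. -/
structure IsEntropyFn (H : Finset (ℕ × ℕ) → ℝ) : Prop where
  empty : H ∅ = 0
  mono : ∀ {F G : Finset (ℕ × ℕ)}, F ⊆ G → H F ≤ H G
  anti : ∀ (F : Finset (ℕ × ℕ)) {G G' : Finset (ℕ × ℕ)}, G ⊆ G' →
    H (F ∪ G') + H G ≤ H (F ∪ G) + H G'
  shift : ∀ (s : ℕ) (F : Finset (ℕ × ℕ)), H (F.image fun p => (p.1 + s, p.2)) = H F

/-- The conditional entropy `H(F | G)`. -/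
def cnd (H : Finset (ℕ × ℕ) → ℝ) (F G : Finset (ℕ × ℕ)) : ℝ := H (F ∪ G) - H G

/-- Times in `[a, b)`, rows below `i`. -/
def rect (a b i : ℕ) : Finset (ℕ × ℕ) := Finset.Ico a b ×ˢ Finset.range i

/-- Times in `[a, b)`, the single row `i`. -/
def rowSeg (a b i : ℕ) : Finset (ℕ × ℕ) := Finset.Ico a b ×ˢ {i}

/-- The entropy rate of the first `i` rows. -/
def rate (H : Finset (ℕ × ℕ) → ℝ) (i : ℕ) : ℝ := ⨅ n, cnd H (rect 0 1 i) (rect 1 (n + 1) i)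

theorem mem_rect {a b i : ℕ} {p : ℕ × ℕ} : p ∈ rect a b i ↔ (a ≤ p.1 ∧ p.1 < b) ∧ p.2 < i := by
  simp [rect]

theorem mem_rowSeg {a b i : ℕ} {p : ℕ × ℕ} :
    p ∈ rowSeg a b i ↔ (a ≤ p.1 ∧ p.1 < b) ∧ p.2 = i := by
  rw [rowSeg, Finset.mem_product]; simp

theorem rect_image_shift (a b i s : ℕ) :
    (rect a b i).image (fun p => (p.1 + s, p.2)) = rect (a + s) (b + s) i := by
  ext ⟨m, q⟩
  simp only [Finset.mem_image, mem_rect, Prod.mk.injEq, Prod.exists]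
  constructor
  · rintro ⟨m', q', h, rfl, rfl⟩; omega
  · intro h; exact ⟨m - s, q, by omega, by omega, rfl⟩

theorem rowSeg_image_shift (a b i s : ℕ) :
    (rowSeg a b i).image (fun p => (p.1 + s, p.2)) = rowSeg (a + s) (b + s) i := by
  ext ⟨m, q⟩
  simp only [Finset.mem_image, mem_rowSeg, Prod.mk.injEq, Prod.exists]
  constructor
  · rintro ⟨m', q', h, rfl, rfl⟩; omega
  · intro h; exact ⟨m - s, q, by omega, by omega, rfl⟩

theorem rect_union_rect (i : ℕ) {a b c : ℕ} (h : a ≤ b) (h' : b ≤ c) :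
    rect a b i ∪ rect b c i = rect a c i := by
  ext ⟨m, q⟩
  simp only [Finset.mem_union, mem_rect]
  omega

namespace IsEntropyFn

variable {H : Finset (ℕ × ℕ) → ℝ} (hH : IsEntropyFn H)

include hH

theorem cnd_nonneg (F G : Finset (ℕ × ℕ)) : 0 ≤ cnd H F G :=
  sub_nonneg.2 (hH.mono Finset.subset_union_right)

theorem cnd_anti (F : Finset (ℕ × ℕ)) {G G' : Finset (ℕ × ℕ)} (h : G ⊆ G') :
    cnd H F G' ≤ cnd H F G := by
  have := hH.anti F h
  unfold cnd; linarith

theorem cnd_shift (s : ℕ) (F G : Finset (ℕ × ℕ)) :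
    cnd H (F.image fun p => (p.1 + s, p.2)) (G.image fun p => (p.1 + s, p.2)) = cnd H F G := by
  unfold cnd
  rw [← Finset.image_union, hH.shift, hH.shift]

omit hH in
theorem cnd_union (F F' G : Finset (ℕ × ℕ)) :
    cnd H (F ∪ F') G = cnd H F (F' ∪ G) + cnd H F' G := by
  unfold cnd
  rw [Finset.union_assoc]; ring

theorem cnd_rect_antitone (Q i : ℕ) :
    Antitone fun n => cnd H (rect 0 1 Q) (rect 1 (n + 1) i) := by
  intro m n hmn
  refine hH.cnd_anti _ fun p hp => ?_
  rw [mem_rect] at hp ⊢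
  omega

theorem bddBelow_cnd_rect (Q i : ℕ) :
    BddBelow (range fun n => cnd H (rect 0 1 Q) (rect 1 (n + 1) i)) :=
  ⟨0, by rintro _ ⟨n, rfl⟩; exact hH.cnd_nonneg _ _⟩

theorem tendsto_rate (i : ℕ) :
    Tendsto (fun n => cnd H (rect 0 1 i) (rect 1 (n + 1) i)) atTop (𝓝 (rate H i)) :=
  tendsto_atTop_ciInf (hH.cnd_rect_antitone i i) (hH.bddBelow_cnd_rect i i)

theorem rate_le (i n : ℕ) : rate H i ≤ cnd H (rect 0 1 i) (rect 1 (n + 1) i) :=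
  ciInf_le (hH.bddBelow_cnd_rect i i) n

theorem sum_cnd_rect (i n : ℕ) :
    ∑ m ∈ Finset.range n, cnd H (rect 0 1 i) (rect 1 (m + 1) i) = H (rect 0 n i) := by
  induction n with
  | zero => simp [rect, hH.empty]
  | succ n ih =>
    rw [Finset.sum_range_succ, ih, cnd, rect_union_rect i (by omega) (by omega)]
    have := hH.shift 1 (rect 0 n i)
    rw [rect_image_shift, zero_add] at this
    rw [this]; ring

theorem tendsto_div_rate (i : ℕ) :
    Tendsto (fun n : ℕ => (n : ℝ)⁻¹ * H (rect 0 n i)) atTop (𝓝 (rate H i)) := by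
  have := (hH.tendsto_rate i).cesaro
  simpa only [hH.sum_cnd_rect] using this

theorem mul_rate_le (i n : ℕ) : n * rate H i ≤ H (rect 0 n i) := by
  rw [← hH.sum_cnd_rect, ← nsmul_eq_mul, ← Finset.card_range n, Finset.card_range]
  simpa using Finset.card_nsmul_le_sum (Finset.range n) _ (rate H i) fun m _ => hH.rate_le i m

theorem le_rate {i : ℕ} {r C : ℝ} (h : ∀ n : ℕ, r * n - C ≤ H (rect 0 n i)) : r ≤ rate H i := by
  have h1 : Tendsto (fun n : ℕ => r - C * (n : ℝ)⁻¹) atTop (𝓝 (r - C * 0)) :=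
    tendsto_const_nhds.sub (tendsto_inv_atTop_nhds_zero_nat.const_mul C)
  rw [mul_zero, sub_zero] at h1
  refine le_of_tendsto_of_tendsto h1 (hH.tendsto_div_rate i) ?_
  filter_upwards [eventually_gt_atTop 0] with n hn
  have hn' : (0 : ℝ) < n := by exact_mod_cast hn
  have := mul_le_mul_of_nonneg_left (h n) (inv_nonneg.2 hn'.le)
  calc r - C * (n : ℝ)⁻¹ = (n : ℝ)⁻¹ * (r * n - C) := by field_simp
    _ ≤ _ := this

/-- Conditioning the present on the future rows below `Q` only. -/
theorem mul_rate_le_cnd (i n M : ℕ) : n * rate H i ≤ cnd H (rect 0 n i) (rect n (n + M) i) := by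
  rw [cnd, rect_union_rect i (by omega) (by omega)]
  have h1 := hH.shift n (rect 0 M i)
  rw [rect_image_shift, zero_add, add_comm M n] at h1
  rw [h1, ← hH.sum_cnd_rect i (n + M), ← hH.sum_cnd_rect i M, add_comm n M,
    Finset.sum_range_add, add_sub_cancel_left]
  simpa using Finset.card_nsmul_le_sum (Finset.range n) _ (rate H i)
    fun m _ => hH.rate_le i (M + m)

theorem cnd_rect_ge (i s M : ℕ) :
    s * rate H (i + 1) + s * rate H i - H (rect 0 s (i + 1)) ≤
      cnd H (rect 0 s i) (rect s (s + M) (i + 1)) := by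
  have h1 := hH.mul_rate_le_cnd (i + 1) s M
  have h2 := hH.mul_rate_le i s
  have h3 := cnd_union (H := H) (rect 0 s (i + 1)) (rect 0 s i) (rect s (s + M) (i + 1))
  have h4 := hH.cnd_anti (rect 0 s (i + 1))
    (Finset.subset_union_left (s₁ := rect 0 s i) (s₂ := rect s (s + M) (i + 1)))
  have h5 : rect 0 s (i + 1) ∪ rect 0 s i = rect 0 s (i + 1) :=
    Finset.union_eq_left.2 fun p hp => by rw [mem_rect] at hp ⊢; omega
  rw [h5] at h3
  have h6 : cnd H (rect 0 s (i + 1)) (rect 0 s i) = H (rect 0 s (i + 1)) - H (rect 0 s i) := by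
    rw [cnd, h5]
  linarith

theorem cnd_rect_telescope_le (i : ℕ) (a : ℕ → ℕ) (c : ℝ)
    (ha : ∀ t, cnd H (rect 0 1 i) (rect 1 (a t) i ∪ rowSeg t (a t) i) ≤ c) (s L M : ℕ) (hLs : L ≤ s)
    (hM : ∀ t ≤ s, a t + s ≤ M) :
    cnd H (rect (s - L) s i) (rect s M (i + 1)) ≤ L * c := by
  induction L with
  | zero =>
    have : rect (s - 0) s i = ∅ := by
      ext p; rw [mem_rect]; simp
    rw [this]; simp [cnd]
  | succ L ih =>
    have ih := ih (by omega)
    have h1 : rect (s - (L + 1)) s i = rect (s - (L + 1)) (s - L) i ∪ rect (s - L) s i :=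
      (rect_union_rect i (by omega) (by omega)).symm
    rw [h1, cnd_union]
    have h2 : cnd H (rect (s - (L + 1)) (s - L) i) (rect (s - L) s i ∪ rect s M (i + 1)) ≤ c := by
      have hs := hH.cnd_shift (s - (L + 1)) (rect 0 1 i)
        (rect 1 (a (L + 1)) i ∪ rowSeg (L + 1) (a (L + 1)) i)
      rw [Finset.image_union, rect_image_shift, rect_image_shift, rowSeg_image_shift] at hs
      have e1 : rect (0 + (s - (L + 1))) (1 + (s - (L + 1))) i = rect (s - (L + 1)) (s - L) i := by
        congr 1 <;> omega
      rw [e1] at hs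
      refine le_trans (hH.cnd_anti _ ?_) (hs.le.trans (ha (L + 1)))
      have := hM (L + 1) hLs
      intro p hp
      simp only [Finset.mem_union, mem_rect, mem_rowSeg] at hp ⊢
      omega
    push_cast
    linarith

/-- Far enough in the future, a new row carries little information on the present beyond the
future of the old rows. -/
theorem exists_delay (i : ℕ) {η : ℝ} (hη : 0 < η) :
    ∃ t, ∀ N, rate H i - η ≤ cnd H (rect 0 1 i) (rect 1 N i ∪ rowSeg t N i) := by
  by_contra! hcon
  choose a ha using hcon
  have key : ∀ s : ℕ, s * (rate H (i + 1) + η) ≤ H (rect 0 s (i + 1)) := by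
    intro s
    set B := ∑ t ∈ Finset.range (s + 1), a t with hB
    have h1 := hH.cnd_rect_telescope_le i a (rate H i - η) (fun t => (ha t).le) s s (s + B) le_rfl
      fun t ht => by
        have := Finset.single_le_sum (f := a) (fun _ _ => Nat.zero_le _)
          (Finset.mem_range.2 (show t < s + 1 by omega))
        omega
    rw [Nat.sub_self] at h1
    have h2 := hH.cnd_rect_ge i s B
    linarith
  have h3 := hH.le_rate (i := i + 1) (r := rate H (i + 1) + η) (C := 0) fun n => by
    have := key n
    linarith
  linarith

end IsEntropyFn

/-- Delay the row `q` by `k q`. -/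
def delay (k : ℕ → ℕ) (H : Finset (ℕ × ℕ) → ℝ) (F : Finset (ℕ × ℕ)) : ℝ :=
  H (F.image fun p => (p.1 + k p.2, p.2))

theorem IsEntropyFn.delay {H : Finset (ℕ × ℕ) → ℝ} (hH : IsEntropyFn H) (k : ℕ → ℕ) :
    IsEntropyFn (delay k H) where
  empty := by simp [_root_.delay, hH.empty]
  mono h := hH.mono (Finset.image_subset_image h)
  anti F G G' h := by
    simp only [_root_.delay, Finset.image_union]
    exact hH.anti _ (Finset.image_subset_image h)
  shift s F := by
    simp only [_root_.delay]
    rw [← hH.shift s (F.image fun p => (p.1 + k p.2, p.2)), Finset.image_image, Finset.image_image]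
    congr 2
    funext p
    simp only [Function.comp_apply, Prod.mk.injEq, and_true]
    omega

/-- Strong recursion for a delay sequence. -/
def delaySeq (t : ℕ → (ℕ → ℕ) → ℕ) (i : ℕ) : ℕ :=
  t i fun q => if _h : q < i then delaySeq t q else 0
termination_by i

theorem image_delay_congr {k k' : ℕ → ℕ} {F : Finset (ℕ × ℕ)} (h : ∀ p ∈ F, k p.2 = k' p.2) :
    (F.image fun p => (p.1 + k p.2, p.2)) = F.image fun p => (p.1 + k' p.2, p.2) :=
  Finset.image_congr fun p hp => by rw [h p hp]

theorem cnd_delay (k : ℕ → ℕ) (H : Finset (ℕ × ℕ) → ℝ) (F G : Finset (ℕ × ℕ)) :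
    cnd (delay k H) F G = cnd H (F.image fun p => (p.1 + k p.2, p.2))
      (G.image fun p => (p.1 + k p.2, p.2)) := by
  simp only [cnd, delay, Finset.image_union]

theorem rate_delay_congr {k k' : ℕ → ℕ} {i : ℕ} (h : ∀ q < i, k q = k' q)
    (H : Finset (ℕ × ℕ) → ℝ) : rate (delay k H) i = rate (delay k' H) i := by
  unfold rate
  congr 1
  funext n
  rw [cnd_delay, cnd_delay, image_delay_congr (k := k) (k' := k') fun p hp => h _ (mem_rect.1 hp).2,
    image_delay_congr (k := k) (k' := k') fun p hp => h _ (mem_rect.1 hp).2]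

theorem IsEntropyFn.exists_delays_step {H : Finset (ℕ × ℕ) → ℝ} (hH : IsEntropyFn H)
    {η : ℕ → ℝ} (hη : ∀ i, 0 < η i) :
    ∃ k : ℕ → ℕ, ∀ i N, rate (_root_.delay k H) i - η i ≤
      cnd (_root_.delay k H) (rect 0 1 i) (rect 1 N (i + 1)) := by
  have hex : ∀ i (k : ℕ → ℕ), ∃ t, ∀ N, rate (_root_.delay k H) i - η i ≤
      cnd (_root_.delay k H) (rect 0 1 i) (rect 1 N i ∪ rowSeg t N i) :=
    fun i k => (hH.delay k).exists_delay i (hη i)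
  choose t ht using hex
  refine ⟨delaySeq t, fun i N => ?_⟩
  set k := delaySeq t with hk
  set k₀ : ℕ → ℕ := fun q => if _h : q < i then delaySeq t q else 0 with hk₀
  have hki : k i = t i k₀ := by rw [hk, delaySeq]
  have hlt : ∀ q < i, k q = k₀ q := fun q hq => by simp [hk₀, hq, hk]
  have hk₀i : k₀ i = 0 := by simp [hk₀]
  rw [rate_delay_congr hlt]
  refine (ht i k₀ (N + k i)).trans ?_
  rw [cnd_delay, cnd_delay,
    image_delay_congr (k := k) (k' := k₀) fun p hp => hlt _ (mem_rect.1 hp).2]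
  refine hH.cnd_anti _ fun p hp => ?_
  simp only [Finset.mem_image, Finset.mem_union, mem_rect, mem_rowSeg, Prod.exists] at hp ⊢
  obtain ⟨m, q, ⟨h1, h2⟩, rfl⟩ := hp
  rcases (Nat.lt_succ_iff.1 h2).lt_or_eq with h | h
  · exact ⟨m, q, Or.inl ⟨by omega, h⟩, by rw [hlt q h]⟩
  · subst h
    exact ⟨m + k q, q, Or.inr ⟨by omega, rfl⟩, by rw [hk₀i, add_zero]⟩

theorem IsEntropyFn.mul_ciInf_le_cnd {H : Finset (ℕ × ℕ) → ℝ} (hH : IsEntropyFn H) {Q i : ℕ}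
    (hQi : Q ≤ i) {r : ℝ} (hr : ∀ N, r ≤ cnd H (rect 0 1 Q) (rect 1 (N + 1) i)) (n M : ℕ) :
    n * r ≤ cnd H (rect 0 n Q) (rect n (n + M) i) := by
  induction n with
  | zero => simpa using hH.cnd_nonneg _ _
  | succ n ih =>
    rw [← rect_union_rect Q (a := 0) (b := 1) (c := n + 1) (by omega) (by omega), cnd_union]
    have h1 := hH.cnd_shift 1 (rect 0 n Q) (rect n (n + M) i)
    rw [rect_image_shift, rect_image_shift, zero_add] at h1
    have e : n + M + 1 = n + 1 + M := by omega
    rw [e] at h1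
    have h2 : r ≤ cnd H (rect 0 1 Q) (rect 1 (n + 1) Q ∪ rect (n + 1) (n + 1 + M) i) := by
      refine (hr (n + M)).trans (hH.cnd_anti _ fun p hp => ?_)
      simp only [Finset.mem_union, mem_rect] at hp ⊢
      omega
    push_cast
    linarith

/-- For suitable delays, the complete delayed future costs the first `Q` rows of a block of
length `n` at most `n / 2 ^ Q` of their entropy. -/
theorem IsEntropyFn.exists_delays {H : Finset (ℕ × ℕ) → ℝ} (hH : IsEntropyFn H) :
    ∃ k : ℕ → ℕ, ∀ Q n M i : ℕ, n * (rate (_root_.delay k H) Q - (1 / 2) ^ Q) ≤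
      cnd (_root_.delay k H) (rect 0 n Q) (rect n (n + M) i) := by
  obtain ⟨k, hk⟩ := hH.exists_delays_step (η := fun i => (1 / 2 : ℝ) ^ (i + 1))
    fun i => by positivity
  refine ⟨k, ?_⟩
  have hK := hH.delay k
  set K := _root_.delay k H
  have hstep : ∀ Q i N, Q ≤ i → cnd K (rect 0 1 Q) (rect 1 N i) + (rate K i -
      cnd K (rect 0 1 i) (rect 1 N i)) - (1 / 2 : ℝ) ^ (i + 1) ≤
      cnd K (rect 0 1 Q) (rect 1 N (i + 1)) := by
    intro Q i N hQi
    have h1 := hk i N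
    have e : rect 0 1 i ∪ rect 0 1 Q = rect 0 1 i :=
      Finset.union_eq_left.2 fun p hp => by rw [mem_rect] at hp ⊢; omega
    have h2 := cnd_union (H := K) (rect 0 1 i) (rect 0 1 Q) (rect 1 N (i + 1))
    have h3 := cnd_union (H := K) (rect 0 1 i) (rect 0 1 Q) (rect 1 N i)
    have h4 : cnd K (rect 0 1 i) (rect 0 1 Q ∪ rect 1 N (i + 1)) ≤
        cnd K (rect 0 1 i) (rect 0 1 Q ∪ rect 1 N i) :=
      hK.cnd_anti _ (Finset.union_subset_union_right fun p hp => by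
        rw [mem_rect] at hp ⊢; omega)
    rw [e] at h2 h3
    linarith
  have hlevel : ∀ Q j : ℕ, ∀ N, rate K Q - (1 / 2) ^ Q + (1 / 2) ^ (Q + j) ≤
      cnd K (rect 0 1 Q) (rect 1 (N + 1) (Q + j)) := by
    intro Q j
    induction j with
    | zero => intro N; simpa using hK.rate_le Q N
    | succ j ih =>
      intro N
      have hlim := (hK.tendsto_rate (Q + j))
      have h1 : Tendsto (fun n => rate K Q - (1 / 2 : ℝ) ^ Q + (1 / 2) ^ (Q + j) + (rate K (Q + j) -
          cnd K (rect 0 1 (Q + j)) (rect 1 (n + 1) (Q + j))) - (1 / 2 : ℝ) ^ (Q + j + 1)) atTop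
          (𝓝 (rate K Q - (1 / 2 : ℝ) ^ Q + (1 / 2) ^ (Q + j) + (rate K (Q + j) - rate K (Q + j))
            - (1 / 2 : ℝ) ^ (Q + j + 1))) :=
        (tendsto_const_nhds.add (tendsto_const_nhds.sub hlim)).sub tendsto_const_nhds
      have h2 := le_of_tendsto h1 (b := cnd K (rect 0 1 Q) (rect 1 (N + 1) (Q + (j + 1)))) (by
        filter_upwards [eventually_ge_atTop N] with n hn
        have h3 := hstep Q (Q + j) (n + 1) (by omega)
        have h4 := ih n
        have h5 := hK.cnd_rect_antitone Q (Q + j + 1) hn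
        simp only at h5
        rw [← add_assoc]
        linarith)
      have h6 : (1 / 2 : ℝ) ^ (Q + j) = 2 * (1 / 2) ^ (Q + j + 1) := by rw [pow_succ]; ring
      rw [← add_assoc] at h2 ⊢
      linarith
  intro Q n M i
  have h1 := hK.mul_ciInf_le_cnd (Nat.le_add_right Q i)
    (r := rate K Q - (1 / 2) ^ Q) (fun N => by
      have := hlevel Q i N
      have h : (0 : ℝ) < (1 / 2) ^ (Q + i) := by positivity
      linarith) n M
  refine h1.trans (hK.cnd_anti _ fun p hp => ?_)
  rw [mem_rect] at hp ⊢
  omega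

end EntropyFunction

section Observables

variable [MeasurableSpace X]

/-- The joint observable recording whether `T^m x ∈ U q` for `(m, q) ∈ F`. -/
def obs (T : X → X) (U : ℕ → Set X) (F : Finset (ℕ × ℕ)) (x : X) : F → Prop :=
  fun p => T^[p.1.1] x ∈ U p.1.2

/-- The entropy of `obs T U F`. -/
def obsEnt (μ : Measure X) (T : X → X) (U : ℕ → Set X) (F : Finset (ℕ × ℕ)) : ℝ :=
  ent μ (obs T U F)

omit [MeasurableSpace X] in
theorem obs_eq_iff {T : X → X} {U : ℕ → Set X} {F : Finset (ℕ × ℕ)} {x y : X} :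
    obs T U F x = obs T U F y ↔ ∀ p ∈ F, (T^[p.1] x ∈ U p.2 ↔ T^[p.1] y ∈ U p.2) := by
  simp only [obs, funext_iff, eq_iff_iff, Subtype.forall]

theorem fibMeas_mem {s : Set X} (hs : MeasurableSet s) : FibMeas fun x => x ∈ s := by
  intro P
  by_cases hP : P
  · have : (fun x => x ∈ s) ⁻¹' {P} = s := by ext x; simp [hP]
    rwa [this]
  · have : (fun x => x ∈ s) ⁻¹' {P} = sᶜ := by ext x; simp [hP]
    rw [this]; exact hs.compl

theorem fibMeas_obs {T : X → X} (hT : Measurable T) {U : ℕ → Set X} (hU : ∀ q, MeasurableSet (U q))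
    (F : Finset (ℕ × ℕ)) : FibMeas (obs T U F) :=
  FibMeas.pi fun p => (fibMeas_mem (hU p.1.2)).comp (hT.iterate p.1.1)

theorem ent_nonneg {A : Type*} [Fintype A] (μ : Measure X) [IsProbabilityMeasure μ] (u : X → A) :
    0 ≤ ent μ u :=
  Finset.sum_nonneg fun _ _ => Real.negMulLog_nonneg measureReal_nonneg measureReal_le_one

theorem isEntropyFn_obsEnt {μ : Measure X} [IsProbabilityMeasure μ] {T : X → X}
    (hT : MeasurePreserving T μ μ) {U : ℕ → Set X} (hU : ∀ q, MeasurableSet (U q)) :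
    IsEntropyFn (obsEnt μ T U) := by
  have hm := fibMeas_obs hT.measurable hU
  refine ⟨?_, ?_, ?_, ?_⟩
  · refine le_antisymm ?_ (ent_nonneg _ _)
    have h1 : FibMeas (fun _ : X => ()) := fun a => by simp
    refine (ent_le_of_factor μ (v := fun _ : X => ()) h1 fun x y _ => ?_).trans ?_
    · simp [obs_eq_iff]
    · simp [ent]
  · intro F G h
    exact ent_le_of_factor μ (hm G) fun x y hxy =>
      obs_eq_iff.2 fun p hp => obs_eq_iff.1 hxy p (h hp)
  · intro F G G' h
    have h1 := ent_cond_anti μ (w := obs T U G) (hm F) (hm G')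
    have h2 : obsEnt μ T U (F ∪ G') ≤
        ent μ (fun x => (obs T U F x, (obs T U G' x, obs T U G x))) :=
      ent_le_of_factor μ ((hm F).pair ((hm G').pair (hm G))) fun x y hxy => by
        simp only [Prod.mk.injEq, obs_eq_iff] at hxy
        refine obs_eq_iff.2 fun p hp => ?_
        rcases Finset.mem_union.1 hp with hp | hp
        · exact hxy.1 p hp
        · exact hxy.2.1 p hp
    have h3 : ent μ (fun x => (obs T U F x, obs T U G x)) ≤ obsEnt μ T U (F ∪ G) :=
      ent_le_of_factor μ (hm _) fun x y hxy => by
        rw [obs_eq_iff] at hxy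
        simp only [Prod.mk.injEq, obs_eq_iff]
        exact ⟨fun p hp => hxy p (Finset.mem_union_left _ hp),
          fun p hp => hxy p (Finset.mem_union_right _ hp)⟩
    have h4 : ent μ (fun x => (obs T U G' x, obs T U G x)) ≤ obsEnt μ T U G' :=
      ent_le_of_factor μ (hm _) fun x y hxy => by
        simp only [Prod.mk.injEq]
        exact ⟨hxy, obs_eq_iff.2 fun p hp => obs_eq_iff.1 hxy p (h hp)⟩
    have h5 : obsEnt μ T U G = ent μ (obs T U G) := rfl
    linarith
  · intro s F
    have h1 : ent μ (fun x => obs T U F (T^[s] x)) = obsEnt μ T U F :=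
      ent_comp μ (hT.iterate s) (hm F)
    have hF : ∀ x y, obs T U (F.image fun p => (p.1 + s, p.2)) x =
        obs T U (F.image fun p => (p.1 + s, p.2)) y ↔
      obs T U F (T^[s] x) = obs T U F (T^[s] y) := by
      intro x y
      simp only [obs_eq_iff, Finset.mem_image, forall_exists_index, and_imp,
        forall_apply_eq_imp_iff₂, Function.iterate_add_apply]
    rw [← h1]
    refine le_antisymm (ent_le_of_factor μ ((hm F).comp (hT.measurable.iterate s)) fun x y => ?_)
      (ent_le_of_factor μ (hm _) fun x y => ?_)
    · exact (hF x y).2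
    · exact (hF x y).1

/-- The cell of a finite partition containing a given point. -/
theorem IsFinPartition.exists_cell {α : Finset (Set X)} (hα : IsFinPartition α) :
    ∃ c : X → α, ∀ x (A : α), c x = A ↔ x ∈ (A : Set X) := by
  have h : ∀ x, ∃ A : α, x ∈ (A : Set X) := by
    intro x
    have : x ∈ ⋃₀ (α : Set (Set X)) := by rw [hα.2.1]; trivial
    obtain ⟨A, hA, hx⟩ := this
    exact ⟨⟨A, hA⟩, hx⟩
  choose c hc using h
  refine ⟨c, fun x A => ⟨fun h => h ▸ hc x, fun h => ?_⟩⟩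
  by_contra hne
  exact Set.disjoint_left.1 (hα.2.2 (c x).2 A.2 fun h => hne (Subtype.ext h)) (hc x) h

omit [MeasurableSpace X] in
theorem cell_word_preimage {α : Finset (Set X)} {c : X → α}
    (hc : ∀ x (A : α), c x = A ↔ x ∈ (A : Set X)) (T : X → X) (n : ℕ) (g : Fin n → α) :
    (fun x (i : Fin n) => c (T^[i] x)) ⁻¹' {g} = ⋂ i : Fin n, (T^[(i : ℕ)]) ⁻¹' (g i : Set X) := by
  ext x
  simp [funext_iff, hc]

theorem dynH_eq_ent (μ : Measure X) (T : X → X) {α : Finset (Set X)} {c : X → α}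
    (hc : ∀ x (A : α), c x = A ↔ x ∈ (A : Set X)) (n : ℕ) :
    dynH μ T α n = ent μ (fun x (i : Fin n) => c (T^[i] x)) := by
  unfold dynH ent
  refine Finset.sum_congr (by congr!) fun g _ => ?_
  rw [cell_word_preimage hc]
  rfl

theorem dynH_nonneg (μ : Measure X) [IsProbabilityMeasure μ] (T : X → X) (α : Finset (Set X))
    (n : ℕ) : 0 ≤ dynH μ T α n :=
  Finset.sum_nonneg fun _ _ => Real.negMulLog_nonneg measureReal_nonneg measureReal_le_one

theorem entPart_nonneg (μ : Measure X) [IsProbabilityMeasure μ] (T : X → X)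
    (α : Finset (Set X)) : 0 ≤ entPart μ T α :=
  Real.iInf_nonneg fun n => div_nonneg (dynH_nonneg _ _ _ _) (by positivity)

theorem entPart_mul_le (μ : Measure X) [IsProbabilityMeasure μ] (T : X → X)
    (α : Finset (Set X)) (n : ℕ) : entPart μ T α * n ≤ dynH μ T α n := by
  rcases n with _ | n
  · simpa using dynH_nonneg μ T α 0
  · have h : entPart μ T α ≤ dynH μ T α (n + 1) / (n + 1 : ℝ) :=
      ciInf_le ⟨0, by
        rintro _ ⟨m, rfl⟩
        exact div_nonneg (dynH_nonneg _ _ _ _) (by positivity)⟩ n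
    rw [le_div_iff₀ (by positivity)] at h
    exact_mod_cast h

theorem entPart_le_rate {μ : Measure X} [IsProbabilityMeasure μ] {T : X → X}
    (hT : MeasurePreserving T μ μ) {U : ℕ → Set X} (hU : ∀ q, MeasurableSet (U q)) (k : ℕ → ℕ)
    {α : Finset (Set X)} (hα : IsFinPartition α) {Q : ℕ} (hQ : ∀ A ∈ α, ∃ q < Q, U q = A) :
    entPart μ T α ≤ rate (delay k (obsEnt μ T U)) Q := by
  have hH := (isEntropyFn_obsEnt hT hU).delay k
  obtain ⟨c, hc⟩ := hα.exists_cell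
  set K := ∑ q ∈ Finset.range Q, k q with hK
  have hkK : ∀ q < Q, k q ≤ K := fun q hq =>
    Finset.single_le_sum (f := k) (fun _ _ => Nat.zero_le _) (Finset.mem_range.2 hq)
  refine hH.le_rate (C := entPart μ T α * K) fun n => ?_
  rcases lt_or_ge n K with hn | hn
  · have h1 : 0 ≤ delay k (obsEnt μ T U) (rect 0 n Q) := ent_nonneg _ _
    have h2 : entPart μ T α * n ≤ entPart μ T α * K :=
      mul_le_mul_of_nonneg_left (by exact_mod_cast hn.le) (entPart_nonneg μ T α)
    linarith
  · have h1 := entPart_mul_le μ T α (n - K)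
    rw [dynH_eq_ent μ T hc] at h1
    have hcm : FibMeas c := fun A => by
      have : c ⁻¹' {A} = A := by ext x; simp [hc]
      rw [this]; exact hα.1 A A.2
    have hw : FibMeas (fun x (i : Fin (n - K)) => c (T^[i] x)) :=
      FibMeas.pi fun i => hcm.comp (hT.measurable.iterate i)
    rw [← ent_comp μ (hT.iterate K) hw] at h1
    have h2 : ent μ (fun x (i : Fin (n - K)) => c (T^[i] (T^[K] x))) ≤
        delay k (obsEnt μ T U) (rect 0 n Q) := by
      refine ent_le_of_factor μ (fibMeas_obs hT.measurable hU _) fun x y hxy => ?_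
      funext i
      obtain ⟨q, hq, hqA⟩ := hQ _ (c (T^[i] (T^[K] x))).2
      symm
      rw [hc, ← hqA, ← Function.iterate_add_apply]
      have h3 := obs_eq_iff.1 hxy (i + K, q) (Finset.mem_image.2 ⟨(i + K - k q, q), by
        rw [mem_rect]
        have := i.2
        dsimp only
        omega, by
        have := hkK q hq
        simp only [Prod.mk.injEq, and_true]
        omega⟩)
      rw [← h3, hqA]
      have h4 := (hc (T^[i + K] x) (c (T^[i + K] x))).1 rfl
      rwa [Function.iterate_add_apply] at h4 ⊢
    push_cast [Nat.cast_sub hn] at h1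
    linarith

theorem entPart_symm [TopologicalSpace X] [BorelSpace X] (μ : Measure X) (T : X ≃ₜ X)
    (hT : MeasurePreserving T μ μ) {α : Finset (Set X)} (hα : IsFinPartition α) :
    entPart μ T.symm α = entPart μ T α := by
  unfold entPart
  congr 1
  funext n
  congr 1
  unfold dynH
  refine Fintype.sum_equiv (Equiv.arrowCongr Fin.revPerm (Equiv.refl _)) _ _ fun g => ?_
  congr 2
  have hms : MeasurableSet (⋂ i : Fin (n + 1), ((⇑T.symm)^[(i : ℕ)]) ⁻¹' (g i : Set X)) :=
    MeasurableSet.iInter fun i =>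
      (T.symm.continuous.measurable.iterate i) (hα.1 _ (g i).2)
  rw [← (hT.iterate n).measure_preimage hms.nullMeasurableSet]
  congr 1
  have key : ∀ (i : ℕ) (x : X), i ≤ n → (⇑T.symm)^[i] ((⇑T)^[n] x) = (⇑T)^[n - i] x := by
    intro i x hi
    obtain ⟨j, rfl⟩ := Nat.exists_eq_add_of_le hi
    rw [Function.iterate_add_apply, (Function.LeftInverse.iterate T.symm_apply_apply i),
      Nat.add_sub_cancel_left]
  ext x
  simp only [mem_preimage, mem_iInter, Equiv.arrowCongr_apply, Function.comp_apply,
    Equiv.refl_apply]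
  constructor
  · intro h i
    have h1 := h i.rev
    have hi := i.2
    rw [key _ _ (by rw [Fin.val_rev]; omega), Fin.val_rev] at h1
    have h2 : n - (n + 1 - ((i : ℕ) + 1)) = i := by omega
    rw [h2] at h1
    simpa using h1
  · intro h i
    have h1 := h i.rev
    have hi := i.2
    rw [key _ _ (by omega)]
    have h2 : ((i.rev : Fin (n + 1)) : ℕ) = n - i := by rw [Fin.val_rev]; omega
    rw [h2] at h1
    simpa using h1

end Observables

section Separated

variable [MetricSpace X]

/-- `E` is `(n, δ)`-separated for `T`. -/
def IsSep (T : X → X) (n : ℕ) (δ : ℝ) (E : Finset X) : Prop :=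
  ∀ x ∈ E, ∀ y ∈ E, x ≠ y → ∃ i < n, δ < dist (T^[i] x) (T^[i] y)

theorem exists_isSep_card_le [CompactSpace X] {δ : ℝ} (hδ : 0 < δ) :
    ∃ p : ℕ, 0 < p ∧ ∀ (T : X → X) (n : ℕ) (E : Finset X), IsSep T n δ E → E.card ≤ p ^ n := by
  obtain ⟨t, -, htf, ht⟩ :=
    finite_cover_balls_of_compact (isCompact_univ (X := X)) (half_pos hδ)
  have := htf.fintype
  have hc : ∀ x : X, ∃ c : t, dist x c < δ / 2 := by
    intro x
    obtain ⟨c, hc, hx⟩ := mem_iUnion₂.1 (ht (mem_univ x))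
    exact ⟨⟨c, hc⟩, hx⟩
  choose c hc using hc
  refine ⟨Fintype.card t + 1, Nat.succ_pos _, fun T n E hE => ?_⟩
  have hinj : Set.InjOn (fun x (i : Fin n) => c (T^[i] x)) E := by
    intro x hx y hy hxy
    by_contra hne
    obtain ⟨i, hi, hd⟩ := hE x hx y hy hne
    have h1 := congrFun hxy ⟨i, hi⟩
    simp only at h1
    have h2 := hc (T^[i] x)
    have h3 := hc (T^[i] y)
    rw [← h1, dist_comm] at h3
    have := dist_triangle (T^[i] x) (c (T^[i] x)) (T^[i] y)
    linarith
  calc E.card ≤ (Finset.univ : Finset (Fin n → t)).card :=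
        Finset.card_le_card_of_injOn _ (fun _ _ => Finset.mem_coe.2 (Finset.mem_univ _)) hinj
    _ = Fintype.card t ^ n := by simp
    _ ≤ _ := Nat.pow_le_pow_left (Nat.le_succ _) n

theorem abs_birk_le [CompactSpace X] (T : X → X) (f : C(X, ℝ)) (n : ℕ) (x : X) :
    |birk T f n x| ≤ n * ‖f‖ := by
  unfold birk
  refine (Finset.abs_sum_le_sum_abs _ _).trans ?_
  refine (Finset.sum_le_card_nsmul _ _ ‖f‖ fun i _ => f.norm_coe_le_norm _).trans ?_
  simp

theorem bddAbove_sep [CompactSpace X] (T : X → X) (f : C(X, ℝ)) (n : ℕ) {δ : ℝ} (hδ : 0 < δ)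
    (K : Set X) : BddAbove { r : ℝ | ∃ E : Finset X, ↑E ⊆ K ∧
      (∀ x ∈ E, ∀ y ∈ E, x ≠ y → ∃ i < n, δ < dist (T^[i] x) (T^[i] y)) ∧
      r = ∑ x ∈ E, Real.exp (birk T f n x) } := by
  obtain ⟨p, -, hp⟩ := exists_isSep_card_le (X := X) hδ
  refine ⟨(p ^ n : ℕ) * Real.exp (n * ‖f‖), ?_⟩
  rintro _ ⟨E, -, hE, rfl⟩
  refine (Finset.sum_le_card_nsmul _ _ (Real.exp (n * ‖f‖)) fun x _ =>
    Real.exp_le_exp.2 ((le_abs_self _).trans (abs_birk_le T f n x))).trans ?_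
  rw [nsmul_eq_mul]
  gcongr
  exact hp T n E hE

theorem le_sepPn [CompactSpace X] {T : X → X} (f : C(X, ℝ)) {n : ℕ} {δ : ℝ} (hδ : 0 < δ)
    {K : Set X} {E : Finset X} (hEK : ↑E ⊆ K) (hE : IsSep T n δ E) :
    ∑ x ∈ E, Real.exp (birk T f n x) ≤ sepPn T f n δ K :=
  le_csSup (bddAbove_sep T f n hδ K) ⟨E, hEK, hE, rfl⟩

theorem sepPn_pos [CompactSpace X] (T : X → X) (f : C(X, ℝ)) (n : ℕ) {δ : ℝ} (hδ : 0 < δ)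
    {K : Set X} (hK : K.Nonempty) : 0 < sepPn T f n δ K := by
  obtain ⟨x, hx⟩ := hK
  refine lt_of_lt_of_le ?_ (le_sepPn (E := {x}) f hδ (by simpa using hx) ?_)
  · simpa using Real.exp_pos _
  · intro a ha b hb hab
    simp only [Finset.mem_singleton] at ha hb
    exact absurd (ha.trans hb.symm) hab

theorem pres_mono [CompactSpace X] (T : X → X) (f : C(X, ℝ)) {K K' : Set X} (hK : K.Nonempty)
    (h : K ⊆ K') : pres T f K ≤ pres T f K' := by
  refine iSup₂_mono fun δ hδ => limsup_le_limsup (Eventually.of_forall fun n => ?_)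
  refine EReal.coe_le_coe_iff.2 (div_le_div_of_nonneg_right ?_ (Nat.cast_nonneg n))
  refine Real.log_le_log (sepPn_pos T f n hδ hK) (csSup_le_csSup (bddAbove_sep T f n hδ K') ?_ ?_)
  · exact ⟨0, ∅, by simp, by simp, by simp⟩
  · rintro r ⟨E, hE, hr⟩
    exact ⟨E, hE.trans h, hr⟩

omit [MetricSpace X] in
theorem symm_iterate_iterate [TopologicalSpace X] (T : X ≃ₜ X) {i n : ℕ} (hi : i ≤ n) (x : X) :
    (⇑T.symm)^[i] ((⇑T)^[n] x) = (⇑T)^[n - i] x := by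
  obtain ⟨j, rfl⟩ := Nat.exists_eq_add_of_le hi
  rw [Function.iterate_add_apply, (Function.LeftInverse.iterate T.symm_apply_apply i),
    Nat.add_sub_cancel_left]

theorem birk_symm_iterate (T : X ≃ₜ X) (f : X → ℝ) (n : ℕ) (x : X) :
    birk T.symm f n ((⇑T)^[n - 1] x) = birk T f n x := by
  unfold birk
  rw [← Finset.sum_range_reflect]
  refine Finset.sum_congr rfl fun j hj => ?_
  rw [Finset.mem_range] at hj
  rw [symm_iterate_iterate T (by omega)]
  congr 2
  omega

theorem IsSep.image_iterate [DecidableEq X] {T : X ≃ₜ X} {n : ℕ} {δ : ℝ} {E : Finset X}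
    (hE : IsSep T n δ E) : IsSep T.symm n δ (E.image (⇑T)^[n - 1]) := by
  intro x hx y hy hxy
  obtain ⟨a, ha, rfl⟩ := Finset.mem_image.1 hx
  obtain ⟨b, hb, rfl⟩ := Finset.mem_image.1 hy
  obtain ⟨i, hi, hd⟩ := hE a ha b hb fun h => hxy (by rw [h])
  refine ⟨n - 1 - i, by omega, ?_⟩
  rw [symm_iterate_iterate T (by omega), symm_iterate_iterate T (by omega)]
  have : n - 1 - (n - 1 - i) = i := by omega
  rwa [this]

theorem sum_image_iterate [DecidableEq X] (T : X ≃ₜ X) (f : X → ℝ) (n : ℕ) (E : Finset X) :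
    ∑ x ∈ E.image (⇑T)^[n - 1], Real.exp (birk T.symm f n x) =
      ∑ x ∈ E, Real.exp (birk T f n x) := by
  rw [Finset.sum_image (T.injective.iterate _).injOn]
  simp_rw [birk_symm_iterate]

theorem sepPn_univ_le_symm [CompactSpace X] (T : X ≃ₜ X) (f : C(X, ℝ)) (n : ℕ) {δ : ℝ}
    (hδ : 0 < δ) : sepPn T f n δ univ ≤ sepPn T.symm f n δ univ := by
  classical
  refine csSup_le ⟨0, ∅, by simp, by simp, by simp⟩ ?_
  rintro r ⟨E, -, hE, rfl⟩
  rw [← sum_image_iterate]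
  exact le_sepPn f hδ (subset_univ _) (IsSep.image_iterate hE)

theorem pres_symm_univ [CompactSpace X] (T : X ≃ₜ X) (f : C(X, ℝ)) :
    pres T.symm f univ = pres T f univ := by
  unfold pres
  refine iSup_congr fun δ => iSup_congr fun hδ => ?_
  congr 1
  funext n
  have h : sepPn T.symm f n δ univ = sepPn T f n δ univ :=
    le_antisymm (sepPn_univ_le_symm T.symm f n hδ) (sepPn_univ_le_symm T f n hδ)
  rw [h]

/-- Exponential growth rate at least `L`, along a sequence of lengths, of the separated subsets
of `K`. -/
def HasGrowth (T : X → X) (f : X → ℝ) (L : ℝ) (K : Set X) : Prop :=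
  ∃ δ > 0, ∃ C : ℝ, ∃ᶠ n : ℕ in atTop, ∃ E : Finset X, ↑E ⊆ K ∧ IsSep T n δ E ∧
    Real.exp (n * L - C) ≤ ∑ x ∈ E, Real.exp (birk T f n x)

theorem HasGrowth.le_pres [CompactSpace X] {T : X → X} {f : C(X, ℝ)} {L : ℝ} {K : Set X}
    (h : HasGrowth T f L K) : (L : EReal) ≤ pres T f K := by
  obtain ⟨δ, hδ, C, hfreq⟩ := h
  refine le_trans ?_ (le_iSup₂ (f := fun (δ : ℝ) (_ : 0 < δ) => atTop.limsup fun n : ℕ =>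
    ((Real.log (sepPn T f n δ K) / n : ℝ) : EReal)) δ hδ)
  refine EReal.ge_of_forall_gt_iff_ge.1 fun L' hL' => le_limsup_of_frequently_le' ?_
  have hL : 0 < L - L' := sub_pos.2 (EReal.coe_lt_coe_iff.1 hL')
  obtain ⟨m, hm⟩ := exists_nat_gt (C / (L - L'))
  refine (hfreq.and_eventually (eventually_ge_atTop (m + 1))).mono ?_
  rintro n ⟨⟨E, hEK, hE, hsum⟩, hn⟩
  have hn0 : (0 : ℝ) < n := by
    have : 0 < n := by omega
    exact_mod_cast this
  have hmn : (m : ℝ) ≤ n := by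
    have : m ≤ n := by omega
    exact_mod_cast this
  have h1 : n * L - C ≤ Real.log (sepPn T f n δ K) := by
    rw [← Real.log_exp (n * L - C)]
    exact Real.log_le_log (Real.exp_pos _) (hsum.trans (le_sepPn f hδ hEK hE))
  refine EReal.coe_le_coe_iff.2 ?_
  rw [le_div_iff₀ hn0]
  rw [div_lt_iff₀ hL] at hm
  nlinarith

theorem HasGrowth.image_symm [CompactSpace X] {T : X ≃ₜ X} {f : C(X, ℝ)} {L : ℝ} {K K' : Set X}
    (hK : T '' K ⊆ K') (h : HasGrowth T.symm f L K) : HasGrowth T.symm f L K' := by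
  classical
  obtain ⟨δ, hδ, C, hfreq⟩ := h
  refine ⟨δ, hδ, C + ‖f‖ + |L|, ?_⟩
  rw [frequently_atTop] at hfreq ⊢
  intro m
  obtain ⟨n, hn, E, hEK, hE, hsum⟩ := hfreq m
  refine ⟨n + 1, by omega, E.image T, ?_, ?_, ?_⟩
  · rw [Finset.coe_image]
    exact (image_mono hEK).trans hK
  · intro x hx y hy hxy
    obtain ⟨a, ha, rfl⟩ := Finset.mem_image.1 hx
    obtain ⟨b, hb, rfl⟩ := Finset.mem_image.1 hy
    obtain ⟨i, hi, hd⟩ := hE a ha b hb fun h => hxy (by rw [h])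
    refine ⟨i + 1, by omega, ?_⟩
    simpa [Function.iterate_succ_apply] using hd
  · rw [Finset.sum_image T.injective.injOn]
    have h1 : ∀ x ∈ E, Real.exp (-‖f‖) * Real.exp (birk T.symm f n x) ≤
        Real.exp (birk T.symm f (n + 1) (T x)) := by
      intro x _
      rw [← Real.exp_add, Real.exp_le_exp]
      have : birk T.symm f (n + 1) (T x) = birk T.symm f n x + f (T x) := by
        unfold birk
        rw [Finset.sum_range_succ']
        simp [Function.iterate_succ_apply]
      rw [this]
      have := (abs_le.1 (f.norm_coe_le_norm (T x))).1
      linarith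
    refine le_trans ?_ (Finset.sum_le_sum h1)
    rw [← Finset.mul_sum]
    refine le_trans ?_ (mul_le_mul_of_nonneg_left hsum (Real.exp_pos _).le)
    rw [← Real.exp_add, Real.exp_le_exp]
    push_cast
    have := le_abs_self L
    linarith

/-- The points asymptotic to `x`, with prescribed rate of convergence `κ`. -/
def asymSet (T : X → X) (κ : ℕ → ℕ) (x : X) : Set X :=
  { y | ∀ j m : ℕ, κ j ≤ m → dist (T^[m] x) (T^[m] y) ≤ 1 / ((j : ℝ) + 1) }

theorem self_mem_asymSet (T : X → X) (κ : ℕ → ℕ) (x : X) : x ∈ asymSet T κ x := by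
  intro j m _
  rw [dist_self]; positivity

theorem isClosed_asymSet {T : X → X} (hT : Continuous T) (κ : ℕ → ℕ) (x : X) :
    IsClosed (asymSet T κ x) := by
  simp only [asymSet, Set.ofPred_forall]
  refine isClosed_iInter fun j => isClosed_iInter fun m => isClosed_iInter fun _ => ?_
  exact isClosed_le (continuous_const.dist (hT.iterate m)) continuous_const

theorem iterate_mem_asymSet {T : X → X} {κ : ℕ → ℕ} {x y : X} (h : y ∈ asymSet T κ x) (n : ℕ) :
    T^[n] y ∈ asymSet T κ (T^[n] x) := by
  intro j m hm
  rw [← Function.iterate_add_apply, ← Function.iterate_add_apply]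
  exact h j (m + n) (by omega)

theorem asymSet_subset_stableSet (T : X → X) (κ : ℕ → ℕ) (x : X) :
    asymSet T κ x ⊆ stableSet T x := by
  intro y hy
  refine Metric.tendsto_atTop.2 fun ε hε => ?_
  obtain ⟨j, hj⟩ := exists_nat_one_div_lt hε
  refine ⟨κ j, fun m hm => ?_⟩
  rw [Real.dist_0_eq_abs, abs_of_nonneg dist_nonneg]
  exact (hy j m hm).trans_lt hj

theorem tendsto_diam_asymSet (T : X → X) (κ : ℕ → ℕ) (x : X) :
    Tendsto (fun n : ℕ => Metric.diam (T^[n] '' asymSet T κ x)) atTop (𝓝 0) := by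
  refine Metric.tendsto_atTop.2 fun ε hε => ?_
  obtain ⟨j, hj⟩ := exists_nat_one_div_lt (half_pos hε)
  refine ⟨κ j, fun m hm => ?_⟩
  rw [Real.dist_0_eq_abs, abs_of_nonneg Metric.diam_nonneg]
  refine lt_of_le_of_lt (Metric.diam_le_of_forall_dist_le (C := 2 * (1 / ((j : ℝ) + 1)))
    (by positivity) ?_) (by linarith)
  rintro _ ⟨y, hy, rfl⟩ _ ⟨z, hz, rfl⟩
  have h1 := hy j m hm
  have h2 := hz j m hm
  rw [dist_comm] at h1
  have := dist_triangle (T^[m] y) (T^[m] x) (T^[m] z)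
  linarith

/-- A separated set can be passed to the limit along a decreasing sequence of closed sets. -/
theorem exists_isSep_iInter [CompactSpace X] {T : X → X} (hT : Continuous T) (f : C(X, ℝ)) {n : ℕ}
    {δ s : ℝ} (hδ : 0 < δ) {D : ℕ → Set X} (hD : Antitone D) (hDc : ∀ N, IsClosed (D N))
    (h : ∀ N, ∃ E : Finset X, ↑E ⊆ D N ∧ IsSep T n δ E ∧
      s ≤ ∑ x ∈ E, Real.exp (birk T f n x)) :
    ∃ E : Finset X, ↑E ⊆ ⋂ N, D N ∧ IsSep T n (δ / 2) E ∧
      s ≤ ∑ x ∈ E, Real.exp (birk T f n x) := by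
  classical
  obtain ⟨p, -, hp⟩ := exists_isSep_card_le (X := X) hδ
  set Φ : ∀ r : ℕ, ℕ → Set (Fin r → X) := fun r N =>
    {e | (∀ i, e i ∈ D N) ∧ (∀ i j, i ≠ j →
      ∃ l ∈ Finset.range n, δ ≤ dist (T^[l] (e i)) (T^[l] (e j))) ∧
      s ≤ ∑ i, Real.exp (birk T f n (e i))} with hΦ
  have hΦanti : ∀ r, Antitone (Φ r) := fun r N M hNM e he =>
    ⟨fun i => hD hNM (he.1 i), he.2⟩
  have hne : ∀ N, ∃ r ≤ p ^ n, (Φ r N).Nonempty := by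
    intro N
    obtain ⟨E, hED, hE, hs⟩ := h N
    refine ⟨E.card, hp T n E hE, fun i => (E.equivFin.symm i : X), fun i => hED (Finset.coe_mem _),
      ?_, ?_⟩
    · intro i j hij
      obtain ⟨l, hl, hd⟩ := hE _ (E.equivFin.symm i).2 _ (E.equivFin.symm j).2 fun h =>
        hij (E.equivFin.symm.injective (Subtype.ext h))
      exact ⟨l, Finset.mem_range.2 hl, hd.le⟩
    · rw [Equiv.sum_comp E.equivFin.symm (fun x : E => Real.exp (birk T f n x)),
        Finset.sum_coe_sort E fun x => Real.exp (birk T f n x)]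
      exact hs
  have hr : ∃ r, ∀ N, (Φ r N).Nonempty := by
    by_contra! hcon
    choose N hN using hcon
    obtain ⟨r, hr, hrne⟩ := hne (∑ r ∈ Finset.range (p ^ n + 1), N r)
    have h1 := hΦanti r (Finset.single_le_sum (f := N) (fun _ _ => Nat.zero_le _)
      (Finset.mem_range.2 (show r < p ^ n + 1 by omega)))
    rw [hN r] at h1
    exact (hrne.mono h1).ne_empty rfl
  obtain ⟨r, hr⟩ := hr
  have hcont : ∀ l, Continuous (T^[l]) := fun l => hT.iterate l
  have hclosed : ∀ N, IsClosed (Φ r N) := by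
    intro N
    refine IsClosed.inter (s₁ := {e : Fin r → X | ∀ i, e i ∈ D N}) ?_ (IsClosed.inter
      (s₁ := {e : Fin r → X | ∀ i j, i ≠ j →
        ∃ l ∈ Finset.range n, δ ≤ dist (T^[l] (e i)) (T^[l] (e j))}) ?_ ?_)
    · simp only [Set.ofPred_forall]
      exact isClosed_iInter fun i => (hDc N).preimage (continuous_apply i)
    · simp only [Set.ofPred_forall]
      refine isClosed_iInter fun i => isClosed_iInter fun j => isClosed_iInter fun _ => ?_
      have : {e : Fin r → X | ∃ l ∈ Finset.range n, δ ≤ dist (T^[l] (e i)) (T^[l] (e j))} =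
          ⋃ l ∈ Finset.range n, {e : Fin r → X | δ ≤ dist (T^[l] (e i)) (T^[l] (e j))} := by
        ext e; simp
      rw [this]
      refine isClosed_biUnion_finset fun l _ => isClosed_le continuous_const ?_
      exact ((hcont l).comp (continuous_apply i)).dist ((hcont l).comp (continuous_apply j))
    · have hb : ∀ i, Continuous fun e : Fin r → X => birk T f n (e i) := fun i => by
        unfold birk
        exact continuous_finsetSum _ fun j _ =>
          f.continuous.comp ((hcont j).comp (continuous_apply i))
      exact isClosed_le continuous_const
        (continuous_finsetSum _ fun i _ => Real.continuous_exp.comp (hb i))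
  obtain ⟨e, he⟩ := IsCompact.nonempty_iInter_of_sequence_nonempty_isCompact_isClosed (Φ r)
    (fun N => hΦanti r (Nat.le_succ N)) hr (hclosed 0).isCompact hclosed
  rw [mem_iInter] at he
  have hinj : Function.Injective e := by
    intro i j hij
    by_contra hne
    obtain ⟨l, -, hd⟩ := (he 0).2.1 i j hne
    rw [hij, dist_self] at hd
    linarith
  refine ⟨Finset.univ.image e, ?_, ?_, ?_⟩
  · intro x hx
    simp only [Finset.coe_image, Finset.coe_univ, image_univ, mem_range] at hx
    obtain ⟨i, rfl⟩ := hx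
    exact mem_iInter.2 fun N => (he N).1 i
  · intro x hx y hy hxy
    obtain ⟨i, -, rfl⟩ := Finset.mem_image.1 hx
    obtain ⟨j, -, rfl⟩ := Finset.mem_image.1 hy
    obtain ⟨l, hl, hd⟩ := (he 0).2.1 i j fun h => hxy (by rw [h])
    exact ⟨l, Finset.mem_range.1 hl, by linarith⟩
  · rw [Finset.sum_image hinj.injOn]
    exact (he 0).2.2

end Separated

section Generator

variable [MeasurableSpace X]

theorem isFinPartition_singleton_univ : IsFinPartition ({univ} : Finset (Set X)) :=
  ⟨by simp, by simp, by simp⟩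

theorem exists_seq_isFinPartition (μ : Measure X) (T : X → X) :
    ∃ α : ℕ → Finset (Set X), (∀ j, IsFinPartition (α j)) ∧
      ∀ r : ℝ, (r : EReal) < mEnt μ T → ∃ j, r < entPart μ T (α j) := by
  have h : ∀ r : ℚ, ∃ α : Finset (Set X), IsFinPartition α ∧
      ((((r : ℝ) : EReal) < mEnt μ T) → (r : ℝ) < entPart μ T α) := by
    intro r
    by_cases hr : ((r : ℝ) : EReal) < mEnt μ T
    · obtain ⟨α, hr⟩ := lt_iSup_iff.1 hr
      obtain ⟨hα, hr⟩ := lt_iSup_iff.1 hr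
      exact ⟨α, hα, fun _ => EReal.coe_lt_coe_iff.1 hr⟩
    · exact ⟨{univ}, isFinPartition_singleton_univ, fun h => absurd h hr⟩
  choose α hα h using h
  obtain ⟨e, he⟩ := exists_surjective_nat ℚ
  refine ⟨α ∘ e, fun j => hα _, fun r hr => ?_⟩
  obtain ⟨q, hrq, hq⟩ := EReal.lt_iff_exists_rat_btwn.1 hr
  obtain ⟨j, rfl⟩ := he q
  exact ⟨j, (EReal.coe_lt_coe_iff.1 hrq).trans (h _ hq)⟩

/-- A sequence of measurable sets which separates points uniformly and contains the members of
countably many prescribed finite families. -/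
theorem exists_generating_seq [MetricSpace X] [CompactSpace X] [BorelSpace X]
    (α : ℕ → Finset (Set X)) (hα : ∀ j, ∀ A ∈ α j, MeasurableSet A) :
    ∃ U : ℕ → Set X, (∀ q, MeasurableSet (U q)) ∧
      (∀ ε > 0, ∃ i, ∀ x y, (∀ q < i, (x ∈ U q ↔ y ∈ U q)) → dist x y ≤ ε) ∧
      ∀ j, ∃ Q, ∀ A ∈ α j, ∃ q < Q, U q = A := by
  have hc : (TopologicalSpace.countableBasis X ∪ (⋃ j, (α j : Set (Set X))) ∪ {univ}).Countable :=
    ((TopologicalSpace.countable_countableBasis X).union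
      (countable_iUnion fun j => (α j).countable_toSet)).union (countable_singleton _)
  obtain ⟨U, hU⟩ := hc.exists_eq_range ⟨univ, by simp⟩
  have hidx : ∀ A ∈ TopologicalSpace.countableBasis X ∪ (⋃ j, (α j : Set (Set X))) ∪ {univ},
      ∃ q, U q = A := fun A hA => by rwa [hU] at hA
  refine ⟨U, fun q => ?_, fun ε hε => ?_, fun j => ?_⟩
  · have : U q ∈ TopologicalSpace.countableBasis X ∪ (⋃ j, (α j : Set (Set X))) ∪ {univ} := by
      rw [hU]; exact mem_range_self q
    rcases this with (h | h) | h
    · exact (TopologicalSpace.isOpen_of_mem_countableBasis h).measurableSet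
    · obtain ⟨j, hj⟩ := mem_iUnion.1 h
      exact hα j _ hj
    · rw [mem_singleton_iff.1 h]; exact MeasurableSet.univ
  · have h : ∀ x : X, ∃ q, x ∈ U q ∧ IsOpen (U q) ∧ U q ⊆ Metric.ball x (ε / 2) := by
      intro x
      obtain ⟨b, hb, hxb, hsub⟩ :=
        (TopologicalSpace.isBasis_countableBasis X).exists_subset_of_mem_open
        (Metric.mem_ball_self (half_pos hε)) (Metric.isOpen_ball (x := x))
      obtain ⟨q, rfl⟩ := hidx b (Or.inl (Or.inl hb))
      exact ⟨q, hxb, TopologicalSpace.isOpen_of_mem_countableBasis hb, hsub⟩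
    choose q hxq hqo hq using h
    obtain ⟨t, ht⟩ := CompactSpace.elim_nhds_subcover (fun x => U (q x))
      fun x => (hqo x).mem_nhds (hxq x)
    refine ⟨∑ x ∈ t, (q x + 1), fun x y hxy => ?_⟩
    have hx : x ∈ ⋃ z ∈ t, U (q z) := by rw [ht]; trivial
    obtain ⟨z, hz, hx⟩ := mem_iUnion₂.1 hx
    have hlt : q z < ∑ x ∈ t, (q x + 1) :=
      (Nat.lt_succ_self _).trans_le (Finset.single_le_sum (f := fun x => q x + 1)
        (fun _ _ => Nat.zero_le _) hz)
    have h1 := Metric.mem_ball.1 (hq z hx)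
    have h2 := Metric.mem_ball'.1 (hq z ((hxy _ hlt).1 hx))
    have := dist_triangle x z y
    linarith
  · have h : ∀ A : α j, ∃ q, U q = A := fun A => hidx A (Or.inl (Or.inr (mem_iUnion.2 ⟨j, A.2⟩)))
    choose q hq using h
    refine ⟨∑ A, (q A + 1), fun A hA => ⟨q ⟨A, hA⟩, ?_, hq _⟩⟩
    exact (Nat.lt_succ_self _).trans_le (Finset.single_le_sum (f := fun A => q A + 1)
        (fun _ _ => Nat.zero_le _) (Finset.mem_univ (⟨A, hA⟩ : α j)))

end Generator

theorem ent_pair_le_add {A B : Type*} [Fintype A] [Fintype B] [MeasurableSpace X] (μ : Measure X)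
    [IsProbabilityMeasure μ] {u : X → A} {v : X → B} (hu : FibMeas u) (hv : FibMeas v) :
    ent μ (fun x => (u x, v x)) ≤ ent μ u + ent μ v := by
  have h := ent_cond_anti μ (w := fun _ : X => ()) hu hv
  have hw : FibMeas fun _ : X => () := fun a => by simp
  have h1 : ent μ (fun x => (u x, v x)) ≤ ent μ (fun x => (u x, (v x, ()))) :=
    ent_le_of_factor μ (hu.pair (hv.pair hw)) fun x y h => by simpa using h
  have h2 : ent μ (fun x => (u x, ())) ≤ ent μ u :=
    ent_le_of_factor μ hu fun x y h => by simpa using h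
  have h3 : ent μ (fun x => (v x, ())) ≤ ent μ v :=
    ent_le_of_factor μ hv fun x y h => by simpa using h
  have h4 : 0 ≤ ent μ (fun _ : X => ()) := ent_nonneg μ _
  linarith

section Coding

variable [MetricSpace X] [CompactSpace X] [MeasurableSpace X] [BorelSpace X]

/-- Up to a set of small measure, the fibres of `a` are uniformly separated. -/
theorem exists_separated_fibers {A : Type*} [Finite A] (μ : Measure X)
    [IsProbabilityMeasure μ] {a : X → A} (ha : FibMeas a) {κ : ℝ} (hκ : 0 < κ) :
    ∃ W : Set X, MeasurableSet W ∧ μ.real Wᶜ < κ ∧ ∃ δ > 0, ∀ x ∈ W, ∀ y ∈ W, dist x y < δ →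
      a x = a y := by
  have := Fintype.ofFinite A
  have hK : ∀ c, ∃ K ⊆ a ⁻¹' {c}, IsCompact K ∧
      μ (a ⁻¹' {c} \ K) < ENNReal.ofReal (κ / (Fintype.card A + 1)) := fun c =>
    (ha c).exists_isCompact_sdiff_lt (measure_ne_top _ _)
      (ENNReal.ofReal_pos.2 (by positivity)).ne'
  choose K hKa hKc hKμ using hK
  have hKm : ∀ c, MeasurableSet (K c) := fun c => (hKc c).measurableSet
  refine ⟨⋃ c, K c, MeasurableSet.iUnion hKm, ?_, ?_⟩
  · have h1 : (⋃ c, K c)ᶜ ⊆ ⋃ c, (a ⁻¹' {c} \ K c) := by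
      intro x hx
      simp only [mem_compl_iff, mem_iUnion, not_exists] at hx
      exact mem_iUnion.2 ⟨a x, rfl, hx _⟩
    have h2 : ∀ c, μ.real (a ⁻¹' {c} \ K c) ≤ κ / (Fintype.card A + 1) := fun c =>
      ENNReal.toReal_le_of_le_ofReal (by positivity) (hKμ c).le
    calc μ.real (⋃ c, K c)ᶜ ≤ μ.real (⋃ c, (a ⁻¹' {c} \ K c)) := measureReal_mono h1
      _ ≤ ∑ c, μ.real (a ⁻¹' {c} \ K c) := measureReal_iUnion_fintype_le _
      _ ≤ ∑ c : A, κ / (Fintype.card A + 1) := Finset.sum_le_sum fun c _ => h2 c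
      _ = Fintype.card A * κ / (Fintype.card A + 1) := by simp [mul_div_assoc]
      _ < κ := by rw [div_lt_iff₀ (by positivity)]; nlinarith
  · have h : ∀ c c', ∃ r > (0 : ℝ), c ≠ c' → ∀ x ∈ K c, ∀ y ∈ K c', r ≤ dist x y := by
      intro c c'
      by_cases hcc : c = c'
      · exact ⟨1, one_pos, fun h => absurd hcc h⟩
      · have hd : Disjoint (K c) (K c') := by
          refine Set.disjoint_left.2 fun x hx hx' => hcc ?_
          rw [← hKa c hx, ← hKa c' hx']
        obtain ⟨r, hr, h⟩ := Metric.exists_pos_forall_lt_edist (hKc c) (hKc c').isClosed hd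
        refine ⟨r, hr, fun _ x hx y hy => ?_⟩
        have := h x hx y hy
        rw [edist_dist, ← ENNReal.ofReal_coe_nnreal] at this
        exact (ENNReal.ofReal_lt_ofReal_iff'.1 this).1.le
    choose r hr h using h
    have hev : ∀ᶠ δ in 𝓝[>] (0 : ℝ), ∀ c c', δ < r c c' :=
      eventually_all.2 fun c => eventually_all.2 fun c' =>
        (eventually_lt_nhds (hr c c')).filter_mono nhdsWithin_le_nhds
    obtain ⟨δ, hδr, hδ⟩ := (hev.and self_mem_nhdsWithin).exists
    refine ⟨δ, hδ, fun x hx y hy hxy => ?_⟩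
    obtain ⟨c, hx⟩ := mem_iUnion.1 hx
    obtain ⟨c', hy⟩ := mem_iUnion.1 hy
    have h1 : a x = c := hKa c hx
    have h2 : a y = c' := hKa c' hy
    rw [h1, h2]
    by_contra hne
    have h3 := hxy.trans (hδr c c')
    exact absurd (h c c' hne x hx y hy) (not_le.2 h3)

/-- A finite-valued observable is almost determined by an approximation of the point. -/
theorem exists_ent_pair_le {A : Type*} [Fintype A] (μ : Measure X) [IsProbabilityMeasure μ]
    {a : X → A} (ha : FibMeas a) {θ : ℝ} (hθ : 0 < θ) :
    ∃ δ₀ > 0, ∀ {E : Type*} [Fintype E] (ξ : X → E) (_ : FibMeas ξ) (S : X → X)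
      (_ : MeasurePreserving S μ μ) (p : E → X) (_ : ∀ x, dist (S x) (p (ξ x)) ≤ δ₀),
      ent μ (fun x => (a (S x), ξ x)) ≤ ent μ ξ + θ := by
  classical
  have hcont : Continuous fun t : ℝ => t * Real.log (Fintype.card A) + Real.negMulLog t +
      Real.negMulLog (1 - t) := by
    have h1 := Real.continuous_negMulLog
    have h2 := h1.comp (continuous_const.sub continuous_id : Continuous fun t : ℝ => 1 - t)
    exact ((continuous_id.mul continuous_const).add h1).add h2
  obtain ⟨κ, hκ, hκθ⟩ := Metric.continuousAt_iff.1 (hcont.continuousAt (x := 0)) θ hθ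
  obtain ⟨W, hWm, hWκ, δ, hδ, hWδ⟩ := exists_separated_fibers μ ha hκ
  refine ⟨δ / 3, by positivity, fun {E} _ ξ hξ S hS p hp => ?_⟩
  set err : X → Bool := fun x => decide (S x ∈ W) with herr
  have hpre_true : err ⁻¹' {true} = S ⁻¹' W := by ext x; simp [herr]
  have hpre_false : err ⁻¹' {false} = S ⁻¹' Wᶜ := by ext x; simp [herr]
  have herrm : FibMeas err := by
    rintro (_ | _)
    · rw [hpre_false]; exact hS.measurable hWm.compl
    · rw [hpre_true]; exact hS.measurable hWm
  have haS : FibMeas fun x => a (S x) := ha.comp hS.measurable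
  set s : Bool × E → Finset A := fun b => if b.1 then
    Finset.univ.filter fun c => ∃ y ∈ W, a y = c ∧ dist y (p b.2) ≤ δ / 3 else Finset.univ with hs
  have hG := ent_pair_sub_add_le μ (v := fun x => (err x, ξ x)) haS (fun _ _ => 0) s ?_
  · have hlog : ∀ b : Bool × E, Real.log (∑ c ∈ s b, Real.exp 0) ≤
        (if b.1 = false then Real.log (Fintype.card A) else 0) := by
      rintro ⟨b, e⟩
      cases b
      · simp [hs]
      · simp only [hs, if_true, Real.exp_zero, Finset.sum_const, nsmul_eq_mul, mul_one,
          Bool.true_eq_false, if_false]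
        refine Real.log_nonpos (Nat.cast_nonneg _) ?_
        rw [Nat.cast_le_one, Finset.card_le_one]
        intro c hc c' hc'
        obtain ⟨y, hy, rfl, hyd⟩ := (Finset.mem_filter.1 hc).2
        obtain ⟨y', hy', rfl, hyd'⟩ := (Finset.mem_filter.1 hc').2
        refine hWδ y hy y' hy' ?_
        have := dist_triangle_right y y' (p e)
        linarith
    have hbound : ∑ b, μ.real ((fun x => (err x, ξ x)) ⁻¹' {b}) *
        Real.log (∑ c ∈ s b, Real.exp 0) ≤ μ.real Wᶜ * Real.log (Fintype.card A) := by
      refine (Finset.sum_le_sum fun b _ => mul_le_mul_of_nonneg_left (hlog b)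
        measureReal_nonneg).trans (le_of_eq ?_)
      have h1 : ∀ e, (fun x => (err x, ξ x)) ⁻¹' {(false, e)} = S ⁻¹' Wᶜ ∩ ξ ⁻¹' {e} := by
        intro e
        rw [← hpre_false]
        ext x; simp
      rw [Fintype.sum_prod_type]
      simp only [Fintype.sum_bool, Bool.true_eq_false, if_false, if_true, mul_zero,
        Finset.sum_const_zero, zero_add, h1, ← Finset.sum_mul]
      rw [sum_real_inter_fiber μ hξ, measureReal_def, hS.measure_preimage
        hWm.compl.nullMeasurableSet, ← measureReal_def]
    have hfac : ent μ (fun x => (a (S x), ξ x)) ≤ ent μ (fun x => (a (S x), (err x, ξ x))) :=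
      ent_le_of_factor μ (haS.pair (herrm.pair hξ)) fun x y h => by
        simp only [Prod.mk.injEq] at h ⊢
        exact ⟨h.1, h.2.2⟩
    have hsub := ent_pair_le_add μ herrm hξ
    have herrent : ent μ err = Real.negMulLog (1 - μ.real Wᶜ) + Real.negMulLog (μ.real Wᶜ) := by
      rw [ent, Fintype.sum_bool, hpre_true, hpre_false]
      have h1 : μ.real (S ⁻¹' Wᶜ) = μ.real Wᶜ := by
        rw [measureReal_def, hS.measure_preimage hWm.compl.nullMeasurableSet, ← measureReal_def]
      have h2 : μ.real (S ⁻¹' W) = 1 - μ.real Wᶜ := by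
        rw [← h1, preimage_compl, probReal_compl_eq_one_sub (hS.measurable hWm)]
        ring
      rw [h1, h2]
    have hφ := hκθ (x := μ.real Wᶜ) (by
      rw [Real.dist_0_eq_abs, abs_of_nonneg measureReal_nonneg]; exact hWκ)
    simp only [zero_mul, sub_zero, Real.negMulLog_zero, Real.negMulLog_one, add_zero,
      Real.dist_0_eq_abs] at hφ
    have := (le_abs_self _).trans_lt hφ
    simp only [mul_zero, Finset.sum_const_zero, add_zero] at hG
    linarith
  · rintro c ⟨b, e⟩ hc
    have : (fun x => a (S x)) ⁻¹' {c} ∩ (fun x => (err x, ξ x)) ⁻¹' {(b, e)} = ∅ := by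
      refine eq_empty_of_forall_notMem ?_
      rintro x ⟨hx1, hx2⟩
      simp only [mem_preimage, mem_singleton_iff, Prod.mk.injEq] at hx1 hx2
      obtain ⟨rfl, rfl⟩ := hx2
      refine hc ?_
      simp only [hs]
      split_ifs with h
      · refine Finset.mem_filter.2 ⟨Finset.mem_univ _, S x, ?_, hx1, hp x⟩
        simpa [herr] using h
      · exact Finset.mem_univ _
    rw [this, measureReal_empty]

end Coding

section Quantization

/-- Measurable choice of an index from a finite measurable cover. -/
theorem exists_fibMeas_mem [MeasurableSpace X] {E : Type*} [Finite E] {R : E → Set X}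
    (hR : ∀ e, MeasurableSet (R e)) (hc : ∀ x, ∃ e, x ∈ R e) :
    ∃ ξ : X → E, FibMeas ξ ∧ ∀ x, x ∈ R (ξ x) := by
  classical
  obtain ⟨ι, hι⟩ := exists_injective_nat E
  have hp : ∀ x, ∃ m, ∃ e, ι e = m ∧ x ∈ R e := fun x => by
    obtain ⟨e, he⟩ := hc x
    exact ⟨ι e, e, rfl, he⟩
  have hm := measurable_find hp fun m => by
    have : {x | ∃ e, ι e = m ∧ x ∈ R e} = ⋃ e ∈ {e | ι e = m}, R e := by ext x; simp
    rw [this]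
    exact MeasurableSet.biUnion (Set.to_countable _) fun e _ => hR e
  choose ξ hξ hξR using fun x => Nat.find_spec (hp x)
  refine ⟨ξ, fun e => ?_, hξR⟩
  have : ξ ⁻¹' {e} = (fun x => Nat.find (hp x)) ⁻¹' {ι e} := by
    ext x
    simp only [mem_preimage, mem_singleton_iff]
    rw [← hξ x]
    exact hι.eq_iff.symm
  rw [this]
  exact hm (measurableSet_singleton _)

variable [MetricSpace X] [CompactSpace X]

theorem exists_maximal_isSep (T : X → X) (n : ℕ) {δ : ℝ} (hδ : 0 < δ) (K : Set X) :
    ∃ E : Finset X, ↑E ⊆ K ∧ IsSep T n δ E ∧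
      ∀ x ∈ K, ∃ e ∈ E, ∀ i < n, dist (T^[i] x) (T^[i] e) ≤ δ := by
  classical
  obtain ⟨p, -, hp⟩ := exists_isSep_card_le (X := X) hδ
  have hne : {k | ∃ E : Finset X, ↑E ⊆ K ∧ IsSep T n δ E ∧ E.card = k}.Nonempty :=
    ⟨0, ∅, by simp, fun x hx => absurd hx (Finset.notMem_empty x), rfl⟩
  have hbdd : BddAbove {k | ∃ E : Finset X, ↑E ⊆ K ∧ IsSep T n δ E ∧ E.card = k} := by
    refine ⟨p ^ n, ?_⟩
    rintro _ ⟨E, -, hE, rfl⟩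
    exact hp T n E hE
  obtain ⟨E, hEK, hE, hcard⟩ := Nat.sSup_mem hne hbdd
  refine ⟨E, hEK, hE, fun x hx => ?_⟩
  by_contra! hcon
  have hxE : x ∉ E := fun h => by
    obtain ⟨i, -, hi⟩ := hcon x h
    rw [dist_self] at hi
    linarith
  have hins : (insert x E).card ≤ E.card := by
    rw [hcard]
    refine le_csSup hbdd ⟨insert x E, ?_, ?_, rfl⟩
    · rw [Finset.coe_insert]
      exact insert_subset hx hEK
    · intro y hy z hz hyz
      rcases Finset.mem_insert.1 hy with rfl | hy' <;>
        rcases Finset.mem_insert.1 hz with rfl | hz'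
      · exact absurd rfl hyz
      · exact hcon z hz'
      · obtain ⟨i, hi, hd⟩ := hcon y hy'
        exact ⟨i, hi, by rwa [dist_comm]⟩
      · exact hE y hy' z hz' hyz
  rw [Finset.card_insert_of_notMem hxE] at hins
  omega

variable [MeasurableSpace X] [BorelSpace X]

/-- A measurable quantizer refining `v` with values in sets which are separated in each fibre. -/
theorem exists_quantizer {B : Type*} [Finite B] {T : X → X} (hT : Continuous T) {v : X → B}
    (hv : FibMeas v) (n : ℕ) {δ : ℝ} (hδ : 0 < δ) :
    ∃ (E : Finset X) (ξ : X → E), FibMeas ξ ∧ (∀ x, v (ξ x) = v x) ∧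
      (∀ x, ∀ i < n, dist (T^[i] x) (T^[i] (ξ x)) ≤ δ) ∧
      ∀ e ∈ E, ∀ e' ∈ E, v e = v e' → e ≠ e' → ∃ i < n, δ < dist (T^[i] e) (T^[i] e') := by
  classical
  have := Fintype.ofFinite B
  choose F hFv hFs hF using fun b => exists_maximal_isSep T n hδ (v ⁻¹' {b})
  have hvF : ∀ b, ∀ e ∈ F b, v e = b := fun b e he => hFv b he
  set E : Finset X := Finset.univ.biUnion F
  set R : E → Set X := fun e =>
    v ⁻¹' {v e} ∩ ⋂ i ∈ Finset.range n, {x | dist (T^[i] x) (T^[i] (e : X)) ≤ δ} with hR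
  have hRm : ∀ e, MeasurableSet (R e) := fun e =>
    (hv _).inter (MeasurableSet.biInter (Set.to_countable _) fun i _ =>
      (isClosed_le ((hT.iterate i).dist continuous_const) continuous_const).measurableSet)
  have hRc : ∀ x, ∃ e, x ∈ R e := by
    intro x
    obtain ⟨e, he, hd⟩ := hF (v x) x rfl
    exact ⟨⟨e, Finset.mem_biUnion.2 ⟨_, Finset.mem_univ _, he⟩⟩, (hvF _ e he).symm,
      mem_iInter₂.2 fun i hi => hd i (Finset.mem_range.1 hi)⟩
  obtain ⟨ξ, hξ, hξR⟩ := exists_fibMeas_mem hRm hRc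
  refine ⟨E, ξ, hξ, fun x => (hξR x).1.symm, fun x i hi => ?_, ?_⟩
  · exact mem_iInter₂.1 (hξR x).2 i (Finset.mem_range.2 hi)
  · intro e he e' he' hvv hne
    obtain ⟨b, -, heb⟩ := Finset.mem_biUnion.1 he
    obtain ⟨b', -, heb'⟩ := Finset.mem_biUnion.1 he'
    obtain rfl : b = b' := by rw [← hvF b e heb, ← hvF b' e' heb', hvv]
    exact hFs b e heb e' heb' hne

omit [MetricSpace X] [CompactSpace X] [BorelSpace X] in
theorem ent_word_pair_le {A E : Type*} [Fintype A] [Fintype E] (μ : Measure X)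
    [IsProbabilityMeasure μ] {T : X → X} (hT : Measurable T) {a : X → A} (ha : FibMeas a)
    {ξ : X → E} (hξ : FibMeas ξ) {θ : ℝ} {n : ℕ}
    (h : ∀ m < n, ent μ (fun x => (a (T^[m] x), ξ x)) ≤ ent μ ξ + θ) :
    ent μ (fun x => ((fun i : Fin n => a (T^[i] x)), ξ x)) ≤ ent μ ξ + n * θ := by
  induction n with
  | zero =>
    refine (ent_le_of_factor μ hξ fun x y hxy => ?_).trans (by simp)
    simpa using ⟨Subsingleton.elim _ _, hxy⟩
  | succ n ih =>
    have hw : FibMeas fun x (i : Fin n) => a (T^[i] x) := FibMeas.pi fun i => ha.comp (hT.iterate i)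
    have hn : FibMeas fun x => a (T^[n] x) := ha.comp (hT.iterate n)
    have h1 := ent_cond_anti μ (w := ξ) hn hw
    have h2 : ent μ (fun x => ((fun i : Fin (n + 1) => a (T^[i] x)), ξ x)) ≤
        ent μ (fun x => (a (T^[n] x), ((fun i : Fin n => a (T^[i] x)), ξ x))) := by
      refine ent_le_of_factor μ (hn.pair (hw.pair hξ)) fun x y hxy => ?_
      simp only [Prod.mk.injEq] at hxy ⊢
      refine ⟨funext fun i => ?_, hxy.2.2⟩
      induction i using Fin.lastCases with
      | last => exact hxy.1
      | cast i => exact congrFun hxy.2.1 i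
    have h3 := ih fun m hm => h m (by omega)
    have h4 := h n (Nat.lt_succ_self n)
    push_cast
    linarith

omit [BorelSpace X] in
theorem integral_birk [OpensMeasurableSpace X] {μ : Measure X} [IsProbabilityMeasure μ] {T : X → X}
    (hT : MeasurePreserving T μ μ) (f : C(X, ℝ)) (n : ℕ) :
    Integrable (birk T f n) μ ∧ ∫ x, birk T f n x ∂μ = n * ∫ x, f x ∂μ := by
  have hf : Integrable f μ := by
    refine Integrable.of_bound f.continuous.aestronglyMeasurable ‖f‖ ?_
    exact Eventually.of_forall f.norm_coe_le_norm
  have hj : ∀ j, Integrable (fun x => f (T^[j] x)) μ := fun j =>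
    (hT.iterate j).integrable_comp_of_integrable hf
  have hij : ∀ j, ∫ x, f (T^[j] x) ∂μ = ∫ x, f x ∂μ := fun j => by
    have := integral_map (hT.iterate j).measurable.aemeasurable
      (f := f) (by rw [(hT.iterate j).map_eq]; exact hf.aestronglyMeasurable)
    rw [(hT.iterate j).map_eq] at this
    exact this.symm
  constructor
  · exact integrable_finsetSum _ fun j _ => hj j
  · unfold birk
    rw [integral_finsetSum _ fun j _ => hj j]
    simp [hij]

/-- If the conditional entropy of words of length `n` given `v` is large, then the pressure of many
fibres of `v` is large. -/
theorem exists_le_measure_fiber {A : Type*} [Fintype A] {μ : Measure X} [IsProbabilityMeasure μ]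
    {T : X → X} (hTc : Continuous T) (hT : MeasurePreserving T μ μ) (f : C(X, ℝ)) {a : X → A}
    (ha : FibMeas a) {h L : ℝ} (hL : L < h + ∫ x, f x ∂μ) (C : ℝ) :
    ∃ δ > 0, ∃ c > 0, ∀ {B : Type} [Fintype B] (v : X → B) (_ : FibMeas v) (n : ℕ) (_ : 1 ≤ n)
      (_ : n * h - C ≤ ent μ (fun x => ((fun i : Fin n => a (T^[i] x)), v x)) - ent μ v),
      c ≤ μ.real (v ⁻¹' {b | ∃ E : Finset X, ↑E ⊆ v ⁻¹' {b} ∧ IsSep T n δ E ∧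
        Real.exp (n * L - C) ≤ ∑ x ∈ E, Real.exp (birk T f n x)}) := by
  classical
  obtain ⟨η, hη, hηL⟩ : ∃ η > 0, L + 4 * η = h + ∫ x, f x ∂μ :=
    ⟨(h + ∫ x, f x ∂μ - L) / 4, by linarith, by ring⟩
  obtain ⟨δ₁, hδ₁, hfano⟩ := exists_ent_pair_le μ ha hη
  obtain ⟨δ₂, hδ₂, hunif⟩ := Metric.uniformContinuous_iff.1
    (CompactSpace.uniformContinuous_of_continuous f.continuous) η hη
  set δ := min δ₁ (δ₂ / 2) with hδdef
  have hδ : 0 < δ := lt_min hδ₁ (half_pos hδ₂)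
  obtain ⟨p, hp0, hp⟩ := exists_isSep_card_le (X := X) hδ
  have hlogp : 0 ≤ Real.log p := Real.log_nonneg (by exact_mod_cast hp0)
  set M := Real.log p + ‖f‖ + |L| + |C| + 1 with hM
  have hM0 : 0 < M := by positivity
  refine ⟨δ, hδ, 2 * η / M, by positivity, fun {B} _ v hv n hn hent => ?_⟩
  have hn1 : (1 : ℝ) ≤ n := by exact_mod_cast hn
  obtain ⟨E, ξ, hξ, hvξ, hξd, hE⟩ := exists_quantizer hTc hv n hδ
  have hword : ent μ (fun x => ((fun i : Fin n => a (T^[i] x)), ξ x)) ≤ ent μ ξ + n * η :=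
    ent_word_pair_le μ hT.measurable ha hξ fun m hm =>
      hfano ξ hξ _ (hT.iterate m) (fun e => T^[m] e) fun x => (hξd x m hm).trans (min_le_left _ _)
  have hwm : FibMeas fun x (i : Fin n) => a (T^[i] x) :=
    FibMeas.pi fun i => ha.comp (hT.measurable.iterate i)
  have h1 : ent μ (fun x => ((fun i : Fin n => a (T^[i] x)), v x)) ≤
      ent μ (fun x => ((fun i : Fin n => a (T^[i] x)), ξ x)) :=
    ent_le_of_factor μ (hwm.pair hξ) fun x y hxy => by
      simp only [Prod.mk.injEq] at hxy ⊢
      exact ⟨hxy.1, by rw [← hvξ x, ← hvξ y, hxy.2]⟩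
  have h2 : ent μ ξ ≤ ent μ (fun x => (ξ x, v x)) :=
    ent_le_of_factor μ (hξ.pair hv) fun x y hxy => (Prod.mk.injEq .. ▸ hxy).1
  set s : B → Finset E := fun b => Finset.univ.filter fun e => v e = b with hs
  have hG := ent_pair_sub_add_le μ (v := v) hξ (fun e _ => birk T f n e) s (by
    intro e b heb
    have : ξ ⁻¹' {e} ∩ v ⁻¹' {b} = ∅ := by
      refine eq_empty_of_forall_notMem ?_
      rintro x ⟨hx1, hx2⟩
      simp only [mem_preimage, mem_singleton_iff] at hx1 hx2
      exact heb (Finset.mem_filter.2 ⟨Finset.mem_univ _, by rw [← hx1, hvξ, hx2]⟩)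
    rw [this, measureReal_empty])
  have hint : n * ∫ x, f x ∂μ - n * η ≤
      ∑ e, ∑ b, μ.real (ξ ⁻¹' {e} ∩ v ⁻¹' {b}) * birk T f n e := by
    simp_rw [← Finset.sum_mul, sum_real_inter_fiber μ hv]
    rw [← integral_comp_fibMeas μ hξ fun e => birk T f n e]
    obtain ⟨hbi, hbe⟩ := integral_birk hT f n
    have hc : ∫ x, (birk T f n x - n * η) ∂μ = n * ∫ x, f x ∂μ - n * η := by
      rw [integral_sub hbi (integrable_const _), hbe]
      simp
    rw [← hc]
    refine integral_mono (hbi.sub (integrable_const _)) (integrable_comp_fibMeas μ hξ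
      fun e => birk T f n e) fun x => ?_
    have : birk T f n x - birk T f n (ξ x) ≤ ∑ j ∈ Finset.range n, η := by
      unfold birk
      rw [← Finset.sum_sub_distrib]
      refine Finset.sum_le_sum fun j hj => ?_
      have hd : dist (T^[j] x) (T^[j] (ξ x)) < δ₂ :=
        ((hξd x j (Finset.mem_range.1 hj)).trans (min_le_right _ _)).trans_lt (half_lt_self hδ₂)
      exact (le_abs_self _).trans (hunif hd).le
    simp only [Finset.sum_const, Finset.card_range, nsmul_eq_mul] at this
    dsimp only
    linarith
  set G : Set B := {b | ∃ E : Finset X, ↑E ⊆ v ⁻¹' {b} ∧ IsSep T n δ E ∧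
        Real.exp (n * L - C) ≤ ∑ x ∈ E, Real.exp (birk T f n x)} with hGdef
  have hsepb : ∀ b, IsSep T n δ ((s b).map (Function.Embedding.subtype _)) := by
    intro b x hx y hy hxy
    obtain ⟨e, he, rfl⟩ := Finset.mem_map.1 hx
    obtain ⟨e', he', rfl⟩ := Finset.mem_map.1 hy
    have h1 := (Finset.mem_filter.1 he).2
    have h2 := (Finset.mem_filter.1 he').2
    exact hE e e.2 e' e'.2 (h1.trans h2.symm) hxy
  have hZ : ∀ b, μ.real (v ⁻¹' {b}) * Real.log (∑ e ∈ s b, Real.exp (birk T f n e)) ≤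
      μ.real (v ⁻¹' {b}) * (n * L - C) + n * M * (if b ∈ G then μ.real (v ⁻¹' {b}) else 0) := by
    intro b
    by_cases hb0 : v ⁻¹' {b} = ∅
    · simp [hb0]
    obtain ⟨x, hx⟩ := nonempty_iff_ne_empty.2 hb0
    have hpos : 0 < ∑ e ∈ s b, Real.exp (birk T f n e) :=
      Finset.sum_pos (fun _ _ => Real.exp_pos _)
        ⟨ξ x, Finset.mem_filter.2 ⟨Finset.mem_univ _, (hvξ x).trans hx⟩⟩
    by_cases hbG : b ∈ G
    · rw [if_pos hbG, mul_comm (n * M), ← mul_add]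
      refine mul_le_mul_of_nonneg_left ?_ measureReal_nonneg
      have hcard : ((s b).card : ℝ) ≤ (p : ℝ) ^ n := by
        have := hp T n _ (hsepb b)
        rw [Finset.card_map] at this
        exact_mod_cast this
      have hle : ∑ e ∈ s b, Real.exp (birk T f n e) ≤ (p : ℝ) ^ n * Real.exp (n * ‖f‖) := by
        refine (Finset.sum_le_card_nsmul (s b) (fun e => Real.exp (birk T f n e))
          (Real.exp (n * ‖f‖)) fun e _ =>
          Real.exp_le_exp.2 ((le_abs_self _).trans (abs_birk_le T f n e))).trans ?_
        rw [nsmul_eq_mul]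
        exact mul_le_mul_of_nonneg_right hcard (Real.exp_pos _).le
      have hlog := Real.log_le_log hpos hle
      rw [Real.log_mul (by positivity) (by positivity), Real.log_pow, Real.log_exp] at hlog
      have e1 := neg_abs_le L
      have e2 := le_abs_self C
      have e3 := abs_nonneg C
      rw [hM]
      nlinarith
    · rw [if_neg hbG, mul_zero, add_zero]
      refine mul_le_mul_of_nonneg_left ?_ measureReal_nonneg
      rw [Real.log_le_iff_le_exp hpos]
      by_contra! hlt
      refine hbG ⟨(s b).map (Function.Embedding.subtype _), ?_, hsepb b, ?_⟩
      · intro y hy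
        obtain ⟨e, he, rfl⟩ := Finset.mem_map.1 hy
        exact (Finset.mem_filter.1 he).2
      · rw [Finset.sum_map]
        exact hlt.le
  have hsum := Finset.sum_le_sum fun b (_ : b ∈ Finset.univ) => hZ b
  have hvG : ∑ b, (if b ∈ G then μ.real (v ⁻¹' {b}) else 0) = μ.real (v ⁻¹' G) := by
    rw [← sum_real_inter_fiber μ hv (v ⁻¹' G)]
    refine Finset.sum_congr rfl fun b _ => ?_
    split_ifs with hb
    · congr 1
      ext x
      simp only [mem_preimage, mem_singleton_iff, mem_inter_iff]
      exact ⟨fun h => ⟨h ▸ hb, h⟩, fun h => h.2⟩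
    · have : v ⁻¹' G ∩ v ⁻¹' {b} = ∅ := by
        refine eq_empty_of_forall_notMem ?_
        rintro x ⟨hx1, hx2⟩
        simp only [mem_preimage, mem_singleton_iff] at hx1 hx2
        exact hb (hx2 ▸ hx1)
      rw [this, measureReal_empty]
  have hone : ∑ b, μ.real (v ⁻¹' {b}) = 1 := by
    have := sum_real_inter_fiber μ hv univ
    simpa using this
  rw [Finset.sum_add_distrib, ← Finset.sum_mul, hone, ← Finset.mul_sum, hvG] at hsum
  rw [div_le_iff₀ hM0]
  have hfin : n * (2 * η) ≤ n * (μ.real (v ⁻¹' G) * M) := by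
    have : n * (L + 4 * η) = n * (h + ∫ x, f x ∂μ) := by rw [hηL]
    linarith
  exact le_of_mul_le_mul_left hfin (by linarith)

end Quantization

section StableFiber

theorem le_measure_frequently [MeasurableSpace X] {μ : Measure X} [IsFiniteMeasure μ]
    {Y : ℕ → Set X} (hY : ∀ n, MeasurableSet (Y n)) {c : ENNReal} (hc : ∀ n, c ≤ μ (Y n)) :
    MeasurableSet {x | ∃ᶠ n in atTop, x ∈ Y n} ∧ c ≤ μ {x | ∃ᶠ n in atTop, x ∈ Y n} := by
  have h : {x | ∃ᶠ n in atTop, x ∈ Y n} = ⋂ m, ⋃ n ≥ m, Y n := by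
    ext x
    simp [frequently_atTop]
  have hm : ∀ m, MeasurableSet (⋃ n ≥ m, Y n) := fun m =>
    MeasurableSet.iUnion fun n => MeasurableSet.iUnion fun _ => hY n
  have hanti : Antitone fun m => ⋃ n ≥ m, Y n := fun m m' hmm =>
    biUnion_subset_biUnion_left fun n hn => le_trans hmm hn
  rw [h]
  refine ⟨MeasurableSet.iInter hm, ?_⟩
  rw [hanti.measure_iInter (fun m => (hm m).nullMeasurableSet) ⟨0, measure_ne_top _ _⟩]
  exact le_iInf fun m => (hc m).trans (measure_mono (subset_biUnion_of_mem (u := Y)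
    (show m ∈ {n | n ≥ m} from le_refl m)))

/-- The cells of the delayed future after time `n`. -/
def future (k : ℕ → ℕ) (n N : ℕ) : Finset (ℕ × ℕ) :=
  (rect n (n + N) N).image fun p => (p.1 + k p.2, p.2)

theorem mem_future {k : ℕ → ℕ} {n N m q : ℕ} (hq : q < N) (hm : n + k q ≤ m) (hm' : m < n + N) :
    (m, q) ∈ future k n N := by
  refine Finset.mem_image.2 ⟨(m - k q, q), mem_rect.2 ⟨⟨?_, ?_⟩, hq⟩, ?_⟩
  · dsimp only; omega
  · dsimp only; omega
  · simp only [Prod.mk.injEq, and_true]; omega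

theorem future_mono (k : ℕ → ℕ) (n : ℕ) : Monotone (future k n) := by
  intro N M h
  refine Finset.image_subset_image fun p hp => ?_
  rw [mem_rect] at hp ⊢
  omega

variable [MetricSpace X] [CompactSpace X]

/-- Separated sets in all finite approximations of the fibre of `x` produce a separated set in a
set of points asymptotic to an iterate of `x`. -/
theorem exists_isSep_asymSet {T : X ≃ₜ X} (f : C(X, ℝ)) {U : ℕ → Set X} {k ι : ℕ → ℕ}
    (hι : ∀ (j : ℕ) (x y : X), (∀ q < ι j, (x ∈ U q ↔ y ∈ U q)) → dist x y ≤ 1 / ((j : ℝ) + 1))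
    {κ : ℕ → ℕ} (hκ : ∀ j, ∀ q < ι j, k q ≤ κ j) {n n' : ℕ} (hn : n < n') {δ s : ℝ} (hδ : 0 < δ)
    {x : X} (h : ∀ N, ∃ E : Finset X,
      (∀ z ∈ E, obs T U (future k n N) z = obs T U (future k n N) x) ∧ IsSep T n' δ E ∧
      s ≤ ∑ x ∈ E, Real.exp (birk T f n' x)) :
    ∃ E : Finset X, ↑E ⊆ asymSet T κ ((⇑T)^[n' - 1] x) ∧ IsSep T.symm n' (δ / 2) E ∧
      s ≤ ∑ x ∈ E, Real.exp (birk T.symm f n' x) := by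
  classical
  set D : ℕ → Set X := fun N => {z | ∀ j m, ι j ≤ N → n + κ j ≤ m → m < n + N →
    dist ((⇑T)^[m] x) ((⇑T)^[m] z) ≤ 1 / ((j : ℝ) + 1)} with hD
  have hDanti : Antitone D := fun N M hNM z hz j m h1 h2 h3 =>
    hz j m (h1.trans hNM) h2 (h3.trans_le (by omega))
  have hDclosed : ∀ N, IsClosed (D N) := by
    intro N
    simp only [hD, Set.ofPred_forall]
    refine isClosed_iInter fun j => isClosed_iInter fun m => isClosed_iInter fun _ =>
      isClosed_iInter fun _ => isClosed_iInter fun _ => ?_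
    exact isClosed_le (continuous_const.dist (T.continuous.iterate m)) continuous_const
  obtain ⟨E, hED, hE, hs⟩ := exists_isSep_iInter T.continuous f hδ hDanti hDclosed fun N => by
    obtain ⟨E, hE, hsep, hs⟩ := h N
    refine ⟨E, fun z hz j m h1 h2 h3 => hι j _ _ fun q hq => ?_, hsep, hs⟩
    exact (obs_eq_iff.1 (hE z hz) (m, q) (mem_future (hq.trans_le h1)
      ((Nat.add_le_add_left (hκ j q hq) n).trans h2) h3)).symm
  have hasym : ∀ z ∈ E, (⇑T)^[n] z ∈ asymSet T κ ((⇑T)^[n] x) := by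
    intro z hz j m hm
    rw [← Function.iterate_add_apply, ← Function.iterate_add_apply]
    exact mem_iInter.1 (hED hz) (ι j + m + 1) j (m + n) (by omega) (by omega) (by omega)
  refine ⟨E.image (⇑T)^[n' - 1], ?_, hE.image_iterate, ?_⟩
  · intro y hy
    rw [Finset.coe_image] at hy
    obtain ⟨z, hz, rfl⟩ := hy
    have h1 := iterate_mem_asymSet (hasym z hz) (n' - 1 - n)
    rw [← Function.iterate_add_apply, ← Function.iterate_add_apply] at h1
    have h2 : n' - 1 - n + n = n' - 1 := by omega
    rwa [h2] at h1
  · rwa [sum_image_iterate]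

variable [MeasurableSpace X] [BorelSpace X]

omit [MetricSpace X] [CompactSpace X] [BorelSpace X] in
theorem le_ent_word_sub {μ : Measure X} [IsProbabilityMeasure μ] {T : X → X} (hT : Measurable T)
    {U : ℕ → Set X} (hU : ∀ q, MeasurableSet (U q)) {k : ℕ → ℕ} {Q K : ℕ}
    (hK : ∀ q < Q, k q < K) (n : ℕ) (G : Finset (ℕ × ℕ)) :
    cnd (obsEnt μ T U) ((rect 0 n Q).image fun p => (p.1 + k p.2, p.2)) G ≤
      ent μ (fun x => ((fun i : Fin (n + K) => obs T U (rect 0 1 Q) (T^[i] x)), obs T U G x)) -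
        ent μ (obs T U G) := by
  have hm := fibMeas_obs hT hU
  refine sub_le_sub_right (ent_le_of_factor μ ((FibMeas.pi fun i : Fin (n + K) =>
    (hm (rect 0 1 Q)).comp (hT.iterate i)).pair (hm G)) fun x y hxy => ?_) _
  simp only [Prod.mk.injEq, funext_iff (f := fun i : Fin (n + K) => _), obs_eq_iff] at hxy
  refine obs_eq_iff.2 fun p hp => ?_
  rcases Finset.mem_union.1 hp with hp | hp
  · obtain ⟨⟨m, q⟩, hmq, rfl⟩ := Finset.mem_image.1 hp
    rw [mem_rect] at hmq
    have := hK q hmq.2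
    have h1 := hxy.1 ⟨m + k q, by dsimp only at hmq; omega⟩ (0, q) (by simp [mem_rect, hmq.2])
    simpa using h1
  · exact hxy.2 p hp

/-- Points with large growth of separated sets in the backward orbit of their asymptotic sets have
positive measure. -/
theorem exists_measure_pos_hasGrowth {μ : Measure X} [IsProbabilityMeasure μ] {T : X ≃ₜ X}
    (hT : MeasurePreserving T μ μ) (f : C(X, ℝ)) {U : ℕ → Set X} (hU : ∀ q, MeasurableSet (U q))
    {k ι κ : ℕ → ℕ}
    (hι : ∀ (j : ℕ) (x y : X), (∀ q < ι j, (x ∈ U q ↔ y ∈ U q)) → dist x y ≤ 1 / ((j : ℝ) + 1))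
    (hκ : ∀ j, ∀ q < ι j, k q ≤ κ j) {Q : ℕ} {h L : ℝ} (hL : L < h + ∫ x, f x ∂μ)
    (hk : ∀ n M i : ℕ, n * h ≤ cnd (delay k (obsEnt μ T U)) (rect 0 n Q) (rect n (n + M) i)) :
    ∃ Y : Set X, MeasurableSet Y ∧ 0 < μ Y ∧
      ∀ y ∈ Y, HasGrowth T.symm f L (asymSet T κ y) := by
  have hm := fibMeas_obs hT.measurable hU
  set K := ∑ q ∈ Finset.range Q, (k q + 1) + 1 with hKdef
  have hK : ∀ q < Q, k q < K := fun q hq => by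
    have := Finset.single_le_sum (f := fun q => k q + 1) (fun _ _ => Nat.zero_le _)
      (Finset.mem_range.2 hq)
    omega
  obtain ⟨δ, hδ, c, hc, hG⟩ := exists_le_measure_fiber T.continuous hT f (hm (rect 0 1 Q)) hL
    (K * |h|)
  set S : ℕ → ℕ → Set X := fun n N => obs T U (future k n N) ⁻¹' {b | ∃ E : Finset X,
    ↑E ⊆ obs T U (future k n N) ⁻¹' {b} ∧ IsSep T (n + K) δ E ∧
      Real.exp ((n + K : ℕ) * L - K * |h|) ≤ ∑ x ∈ E, Real.exp (birk T f (n + K) x)} with hS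
  have hSm : ∀ n N, MeasurableSet (S n N) := fun n N => (hm _).preimage _
  have hSanti : ∀ n, Antitone (S n) := by
    rintro n N M hNM x ⟨E, hE, h1⟩
    refine ⟨E, fun z hz => obs_eq_iff.2 fun p hp => ?_, h1⟩
    exact obs_eq_iff.1 (hE hz) p (future_mono k n hNM hp)
  have hSc : ∀ n N, ENNReal.ofReal c ≤ μ (S n N) := by
    intro n N
    refine ENNReal.ofReal_le_of_le_toReal (hG _ (hm (future k n N)) (n + K) (by omega) ?_)
    refine le_trans ?_ (le_ent_word_sub hT.measurable hU hK n (future k n N))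
    have h1 := hk n N N
    rw [cnd_delay] at h1
    refine le_trans ?_ h1
    push_cast
    have := mul_le_mul_of_nonneg_left (le_abs_self h) (Nat.cast_nonneg (α := ℝ) K)
    linarith
  set Y : ℕ → Set X := fun n => (⇑T.symm)^[n + K - 1] ⁻¹' ⋂ N, S n N with hY
  have hsymm : MeasurePreserving T.symm μ μ := MeasurePreserving.symm T.toMeasurableEquiv hT
  have hYm : ∀ n, MeasurableSet (Y n) := fun n =>
    (hsymm.iterate _).measurable (MeasurableSet.iInter (hSm n))
  have hYc : ∀ n, ENNReal.ofReal c ≤ μ (Y n) := by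
    intro n
    rw [hY, (hsymm.iterate _).measure_preimage (MeasurableSet.iInter (hSm n)).nullMeasurableSet,
      (hSanti n).measure_iInter (fun N => (hSm n N).nullMeasurableSet) ⟨0, measure_ne_top _ _⟩]
    exact le_iInf (hSc n)
  obtain ⟨hm1, hm2⟩ := le_measure_frequently hYm hYc
  refine ⟨_, hm1, (ENNReal.ofReal_pos.2 hc).trans_le hm2, fun y hy => ?_⟩
  refine ⟨δ / 2, half_pos hδ, K * |h|, frequently_atTop.2 fun m => ?_⟩
  obtain ⟨n, hn, hyn⟩ := frequently_atTop.1 hy m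
  refine ⟨n + K, by omega, ?_⟩
  have hyx : (⇑T)^[n + K - 1] ((⇑T.symm)^[n + K - 1] y) = y :=
    Function.LeftInverse.iterate T.apply_symm_apply _ y
  have := exists_isSep_asymSet (T := T) f hι hκ (n := n) (n' := n + K) (by omega) hδ
    (s := Real.exp ((n + K : ℕ) * L - K * |h|)) (x := (⇑T.symm)^[n + K - 1] y) fun N => by
      obtain ⟨E, hE, h1⟩ := mem_iInter.1 hyn N
      exact ⟨E, fun z hz => hE hz, h1⟩
  rwa [hyx] at this

omit [CompactSpace X] in
theorem ae_of_invariant {μ : Measure X} [IsProbabilityMeasure μ] {T : X ≃ₜ X} (hT : Ergodic T μ)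
    {Z Y : Set X} (hZ : ∀ x ∈ Z, T x ∈ Z) (hYZ : Y ⊆ Z) (hY : MeasurableSet Y) (hY0 : 0 < μ Y) :
    ∀ᵐ x ∂μ, x ∈ Z := by
  have hs : Ergodic T.symm μ := Ergodic.symm (e := T.toMeasurableEquiv) hT
  set V := ⋃ i, (⇑T.symm)^[i] ⁻¹' Y with hV
  have hVm : MeasurableSet V := MeasurableSet.iUnion fun i => (hs.measurable.iterate i) hY
  have hVZ : V ⊆ Z := by
    intro x hx
    obtain ⟨i, hi⟩ := mem_iUnion.1 hx
    have h1 : (⇑T)^[i] ((⇑T.symm)^[i] x) = x :=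
      Function.LeftInverse.iterate T.apply_symm_apply i x
    have h2 : ∀ (j : ℕ) (z : X), z ∈ Z → (⇑T)^[j] z ∈ Z := by
      intro j z hz
      induction j with
      | zero => exact hz
      | succ j ih => rw [Function.iterate_succ_apply']; exact hZ _ ih
    rw [← h1]
    exact h2 i _ (hYZ hi)
  have hpre : T.symm ⁻¹' V ≤ᵐ[μ] V := by
    refine LE.le.eventuallyLE (show T.symm ⁻¹' V ≤ V from fun x hx => ?_)
    obtain ⟨i, hi⟩ := mem_iUnion.1 hx
    exact mem_iUnion.2 ⟨i + 1, by rwa [mem_preimage, Function.iterate_succ_apply]⟩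
  rcases hs.ae_empty_or_univ_of_preimage_ae_le hVm.nullMeasurableSet hpre with h | h
  · have h1 : μ Y ≤ μ V := measure_mono (subset_iUnion (fun i => (⇑T.symm)^[i] ⁻¹' Y) 0)
    rw [measure_congr h, measure_empty] at h1
    exact absurd hY0 (not_lt.2 h1)
  · exact Filter.Eventually.mono (show ∀ᵐ x ∂μ, x ∈ V from eventuallyEq_univ.1 h) hVZ

/-- The pressure of the inverse map on asymptotic sets with a uniform rate of convergence is almost
surely at least the measure-theoretic pressure. -/
theorem exists_ae_mPres_le {μ : Measure X} [IsProbabilityMeasure μ] {T : X ≃ₜ X}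
    (hT : Ergodic T μ) (f : C(X, ℝ)) :
    ∃ κ : ℕ → ℕ, ∀ᵐ y ∂μ, mPres μ T f ≤ pres T.symm f (asymSet T κ y) := by
  have hmp := hT.toMeasurePreserving
  obtain ⟨α, hα, hαent⟩ := exists_seq_isFinPartition μ T
  obtain ⟨U, hU, hsep, hUα⟩ := exists_generating_seq α fun j => (hα j).1
  obtain ⟨k, hk⟩ := (isEntropyFn_obsEnt hmp hU).exists_delays
  choose ι hι using fun j : ℕ => hsep (1 / ((j : ℝ) + 1)) (by positivity)
  set κ : ℕ → ℕ := fun j => ∑ q ∈ Finset.range (ι j), k q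
  have hκ : ∀ j, ∀ q < ι j, k q ≤ κ j := fun j q hq =>
    Finset.single_le_sum (f := k) (fun _ _ => Nat.zero_le _) (Finset.mem_range.2 hq)
  refine ⟨κ, ?_⟩
  have hrat : ∀ q : ℚ, (((q : ℝ) : EReal) < mPres μ T f) →
      ∀ᵐ y ∂μ, HasGrowth T.symm f q (asymSet T κ y) := by
    intro q hq
    have h1 : ((q - ∫ x, f x ∂μ : ℝ) : EReal) < mEnt μ T := by
      by_contra! hle
      have h2 : mPres μ T f ≤ ((q - ∫ x, f x ∂μ : ℝ) : EReal) + ((∫ x, f x ∂μ : ℝ) : EReal) :=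
        add_le_add_left hle _
      rw [← EReal.coe_add, sub_add_cancel] at h2
      exact absurd hq (not_lt.2 h2)
    obtain ⟨r, hqr, hr⟩ := EReal.lt_iff_exists_real_btwn.1 h1
    rw [EReal.coe_lt_coe_iff] at hqr
    obtain ⟨j, hj⟩ := hαent r hr
    obtain ⟨Q₀, hQ₀⟩ := hUα j
    obtain ⟨Q₁, hQ₁⟩ := exists_pow_lt_of_lt_one (sub_pos.2 hqr) (one_half_lt_one (α := ℝ))
    have hpow : (1 / 2 : ℝ) ^ (Q₀ + Q₁) ≤ (1 / 2) ^ Q₁ :=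
      pow_le_pow_of_le_one (by norm_num) (by norm_num) (by omega)
    have hrate := entPart_le_rate hmp hU k (hα j) (Q := Q₀ + Q₁) fun A hA => by
      obtain ⟨q, hq, h⟩ := hQ₀ A hA
      exact ⟨q, by omega, h⟩
    obtain ⟨Y, hYm, hY0, hYg⟩ := exists_measure_pos_hasGrowth hmp f hU hι hκ (L := q)
      (by linarith) (hk (Q₀ + Q₁))
    refine ae_of_invariant (Z := {y | HasGrowth T.symm f q (asymSet T κ y)}) hT
      (fun y hy => ?_) hYg hYm hY0
    refine HasGrowth.image_symm ?_ hy
    rintro _ ⟨z, hz, rfl⟩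
    exact iterate_mem_asymSet hz 1
  have hall : ∀ᵐ y ∂μ, ∀ q : ℚ, (((q : ℝ) : EReal) < mPres μ T f) →
      HasGrowth T.symm f q (asymSet T κ y) := by
    refine ae_all_iff.2 fun q => ?_
    by_cases hq : ((q : ℝ) : EReal) < mPres μ T f
    · exact (hrat q hq).mono fun y hy _ => hy
    · exact Eventually.of_forall fun y h => absurd h hq
  refine hall.mono fun y hy => ?_
  by_contra! hlt
  obtain ⟨q, hq1, hq2⟩ := EReal.lt_iff_exists_rat_btwn.1 hlt
  exact absurd (hy q hq2).le_pres (not_le.2 hq1)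

omit [CompactSpace X] in
theorem mPres_symm {μ : Measure X} [IsProbabilityMeasure μ] {T : X ≃ₜ X}
    (hT : MeasurePreserving T μ μ) (f : X → ℝ) : mPres μ T.symm f = mPres μ T f := by
  unfold mPres mEnt
  congr 1
  exact iSup_congr fun α => iSup_congr fun hα => by rw [entPart_symm μ T hT hα]

end StableFiber

/-- For a TDS `(X,T)` and `f ∈ C(X,ℝ)`: if there is an ergodic
`T`-invariant Borel probability measure `μ` with `P_μ(T,f) = P(T,f)`, then there
is a point `x`, a closed `A(x) ⊆ W^s(x,T)` and a closed `B(x) ⊆ W^u(x,T)` with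
`diam(TⁿA(x)) → 0`, `P(T⁻¹,f,A(x)) = P(T,f)`, `diam(T^{-n}B(x)) → 0` and
`P(T,f,B(x)) = P(T,f)`. -/
theorem stmt11 [MetricSpace X] [CompactSpace X] [MeasurableSpace X] [BorelSpace X]
    (T : X ≃ₜ X) (f : C(X, ℝ)) (μ : Measure X) [IsProbabilityMeasure μ]
    (herg : Ergodic ⇑T μ) (heq : mPres μ ⇑T ⇑f = pres ⇑T ⇑f Set.univ) :
    ∃ x : X,
      (∃ A : Set X, IsClosed A ∧ A ⊆ stableSet ⇑T x ∧
        Tendsto (fun n : ℕ => Metric.diam ((⇑T)^[n] '' A)) atTop (𝓝 0) ∧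
        pres ⇑T.symm ⇑f A = pres ⇑T ⇑f Set.univ) ∧
      (∃ B : Set X, IsClosed B ∧ B ⊆ stableSet ⇑T.symm x ∧
        Tendsto (fun n : ℕ => Metric.diam ((⇑T.symm)^[n] '' B)) atTop (𝓝 0) ∧
        pres ⇑T ⇑f B = pres ⇑T ⇑f Set.univ) := by
  have herg' : Ergodic T.symm μ := Ergodic.symm (e := T.toMeasurableEquiv) herg
  obtain ⟨κ, hκ⟩ := exists_ae_mPres_le herg f
  obtain ⟨κ', hκ'⟩ := exists_ae_mPres_le herg' f
  obtain ⟨x, hx, hx'⟩ := (hκ.and hκ').exists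
  rw [mPres_symm herg.toMeasurePreserving, heq] at hx'
  rw [heq] at hx
  refine ⟨x, ⟨asymSet T κ x, isClosed_asymSet T.continuous κ x, asymSet_subset_stableSet T κ x,
    tendsto_diam_asymSet T κ x, le_antisymm ?_ hx⟩, asymSet T.symm κ' x,
    isClosed_asymSet T.symm.continuous κ' x, asymSet_subset_stableSet T.symm κ' x,
    tendsto_diam_asymSet T.symm κ' x, le_antisymm ?_ hx'⟩
  · rw [← pres_symm_univ]
    exact pres_mono T.symm f ⟨x, self_mem_asymSet T κ x⟩ (subset_univ _)
  · exact pres_mono T f ⟨x, self_mem_asymSet T.symm κ' x⟩ (subset_univ _)
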